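/- Let Y_{n,3} be the number of fringe subtrees with exactly 3 nodes in the linear preferential attachment tree Λ_n with n nodes, and let κ := ρ/(χ+ρ) = w_0/w_1. Then, as n → ∞, n^{−1/2}(Y_{n,3} − κ·n/((κ+2)(κ+3))) converges in distribution to N(0, σ_3²), where σ_3² = 3κ(11κ³ + 52κ² + 77κ + 30) / (2(κ+2)(κ+3)²(2κ+1)(2κ+3)(2κ+5)). In particular σ_3² = 17/336 for the random recursive tree (κ = 1), σ_3² = 8/175 for the binary search tree (κ = 2), and σ_3² = 663/15680 for the plane oriented recursive tree (κ = 1/2). -/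

import Mathlib

open scoped BigOperators

namespace PATpaper

/-- The sample space of the preferential attachment tree with `n` nodes: node `i + 1`
(for `0 ≤ i < n - 1`) chooses its parent among the nodes `0, …, i`. -/
abbrev Omega (n : ℕ) := ∀ i : Fin (n - 1), Fin ((i : ℕ) + 1)

/-- The list of parents: entry `i` is the parent of node `i + 1`. -/
def toList {n : ℕ} (p : Omega n) : List ℕ := (List.finRange (n - 1)).map (fun i => ((p i : ℕ)))

/-- The probability, in the linear preferential attachment model with weights
`w_k = χ k + ρ`, of a given parent list: at the step adding node `i + 1` to the tree
with nodes `0, …, i`, an existing node `v` is chosen as the parent with probability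
`w_{d⁺(v)}` divided by the total weight `(i+1)(χ+ρ) − χ` of the current tree. -/
noncomputable def prob (χ ρ : ℝ) (l : List ℕ) : ℝ :=
  ∏ i ∈ Finset.range l.length,
    ((χ * ((l.take i).count (l.getD i 0) : ℝ) + ρ) / (((i : ℝ) + 1) * (χ + ρ) - χ))

/-- Expectation of a functional of the linear preferential attachment tree with
`n` nodes. -/
noncomputable def expec (χ ρ : ℝ) (n : ℕ) (f : Omega n → ℝ) : ℝ :=
  ∑ p : Omega n, prob χ ρ (toList p) * f p

/-- The list of weak ancestors of node `u` (for a valid parent list, the parent of a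
node is smaller than the node, and `min` is idle). -/
def anc (l : List ℕ) : ℕ → List ℕ
  | 0 => [0]
  | (u + 1) => (u + 1) :: anc l (min (l.getD u 0) u)
decreasing_by exact Nat.lt_succ_of_le (Nat.min_le_right _ _)

open Classical in
/-- The set of (weak) descendants of node `v` among the nodes `0, …, n - 1`:
the vertex set of the fringe subtree rooted at `v`. -/
noncomputable def descSet (l : List ℕ) (n v : ℕ) : Finset ℕ :=
  (Finset.range n).filter (fun u => v ∈ anc l u)

open Classical in
/-- The number of fringe subtrees with exactly `k` nodes. -/
noncomputable def countSize (l : List ℕ) (n k : ℕ) : ℕ :=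
  ((Finset.range n).filter (fun v => (descSet l n v).card = k)).card

open Classical in
/-- The number of nodes with out-degree `k`. -/
noncomputable def countDeg (l : List ℕ) (n k : ℕ) : ℕ :=
  ((Finset.range n).filter (fun v => l.count v = k)).card

open MeasureTheory in
/-- `W_n` converges in distribution, under the linear preferential attachment model,
to the centered normal distribution with variance `v`. -/
def TendstoGaussP (χ ρ : ℝ) (W : (n : ℕ) → Omega n → ℝ) (v : NNReal) : Prop :=
  ∀ f : BoundedContinuousFunction ℝ ℝ,
    Filter.Tendsto (fun n => expec χ ρ n (fun p => f (W n p)))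
      Filter.atTop (nhds (∫ x, f x ∂(ProbabilityTheory.gaussianReal 0 v)))

end PATpaper

namespace PATpaper

/-- The asymptotic variance constant `σ₃²` for the number of fringe subtrees with 3
nodes, as a function of `κ = ρ/(χ+ρ)`. -/
noncomputable def sigma3sq (κ : ℝ) : ℝ :=
  3 * κ * (11 * κ ^ 3 + 52 * κ ^ 2 + 77 * κ + 30) /
    (2 * (κ + 2) * (κ + 3) ^ 2 * (2 * κ + 1) * (2 * κ + 3) * (2 * κ + 5))

section Ancestors

lemma self_mem_anc (l : List ℕ) (u : ℕ) : u ∈ anc l u := by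
  cases u <;> simp [anc]

lemma mem_anc_succ {l : List ℕ} {x u : ℕ} :
    x ∈ anc l (u + 1) ↔ x = u + 1 ∨ x ∈ anc l (min (l.getD u 0) u) := by
  rw [anc, List.mem_cons]

lemma le_of_mem_anc {l : List ℕ} {x u : ℕ} (h : x ∈ anc l u) : x ≤ u := by
  induction u using Nat.strong_induction_on with
  | _ u ih =>
    cases u with
    | zero => simpa [anc] using h
    | succ u =>
      rcases mem_anc_succ.1 h with h | h
      · exact h.le
      · exact (ih _ (by omega) h).trans (by omega)

lemma zero_mem_anc (l : List ℕ) (u : ℕ) : 0 ∈ anc l u := by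
  induction u using Nat.strong_induction_on with
  | _ u ih =>
    cases u with
    | zero => simp [anc]
    | succ u => exact mem_anc_succ.2 (Or.inr (ih _ (by omega)))

lemma mem_anc_trans {l : List ℕ} {x y v : ℕ} (hxy : x ∈ anc l y) (hyv : y ∈ anc l v) :
    x ∈ anc l v := by
  induction v using Nat.strong_induction_on with
  | _ v ih =>
    cases v with
    | zero =>
      obtain rfl : y = 0 := by simpa [anc] using hyv
      exact hxy
    | succ v =>
      rcases mem_anc_succ.1 hyv with rfl | h
      · exact hxy
      · exact mem_anc_succ.2 (Or.inr (ih _ (by omega) h))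

lemma mem_anc_total {l : List ℕ} {x y v : ℕ} (hx : x ∈ anc l v) (hy : y ∈ anc l v) :
    x ∈ anc l y ∨ y ∈ anc l x := by
  induction v using Nat.strong_induction_on with
  | _ v ih =>
    cases v with
    | zero =>
      obtain rfl : x = 0 := by simpa [anc] using hx
      exact Or.inl (zero_mem_anc l y)
    | succ v =>
      rcases mem_anc_succ.1 hx with rfl | hx'
      · exact Or.inr hy
      · rcases mem_anc_succ.1 hy with rfl | hy'
        · exact Or.inl hx
        · exact ih _ (by omega) hx' hy'

lemma eq_of_mem_anc_of_mem_anc {l : List ℕ} {x y : ℕ} (hxy : x ∈ anc l y) (hyx : y ∈ anc l x) :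
    x = y :=
  le_antisymm (le_of_mem_anc hxy) (le_of_mem_anc hyx)

lemma anc_append {l : List ℕ} (v : ℕ) {u : ℕ} (hu : u ≤ l.length) :
    anc (l ++ [v]) u = anc l u := by
  induction u using Nat.strong_induction_on with
  | _ u ih =>
    cases u with
    | zero => simp [anc]
    | succ u =>
      have h : (l ++ [v]).getD u 0 = l.getD u 0 := List.getD_append _ _ _ _ (by omega)
      rw [anc, anc, h, ih _ (by omega) (by omega)]

lemma anc_append_length {l : List ℕ} {v : ℕ} (hv : v ≤ l.length) :
    anc (l ++ [v]) (l.length + 1) = (l.length + 1) :: anc l v := by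
  have h : (l ++ [v]).getD l.length 0 = v := by
    simp [List.getD_eq_getElem?_getD]
  rw [anc, h, min_eq_left hv, anc_append v hv]

end Ancestors

section FringeSize

/-- The number of nodes of the fringe subtree rooted at `x`, in the tree with nodes
`0, …, l.length` and parent list `l`. -/
noncomputable def fringeSize (l : List ℕ) (x : ℕ) : ℕ := (descSet l (l.length + 1) x).card

lemma mem_descSet {l : List ℕ} {n x u : ℕ} : u ∈ descSet l n x ↔ u < n ∧ x ∈ anc l u := by
  simp [descSet]

lemma fringeSize_append {l : List ℕ} {v x : ℕ} (hv : v ≤ l.length) (hx : x ≤ l.length) :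
    fringeSize (l ++ [v]) x = fringeSize l x + if x ∈ anc l v then 1 else 0 := by
  have key : descSet (l ++ [v]) ((l ++ [v]).length + 1) x =
      if x ∈ anc l v then insert (l.length + 1) (descSet l (l.length + 1) x)
      else descSet l (l.length + 1) x := by
    ext u
    rw [mem_descSet, List.length_append, List.length_singleton]
    rcases lt_trichotomy u (l.length + 1) with hu | rfl | hu
    · rw [anc_append v (by omega)]
      split_ifs <;> simp [mem_descSet, hu, hu.ne, Nat.lt_succ_of_lt hu]
    · rw [anc_append_length hv]
      split_ifs with h <;> simp [mem_descSet, h]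
      omega
    · split_ifs <;> simp [mem_descSet] <;> omega
  unfold fringeSize
  rw [key]
  split_ifs
  · rw [Finset.card_insert_of_notMem (by simp [mem_descSet])]
  · rfl

lemma fringeSize_append_length {l : List ℕ} {v : ℕ} :
    fringeSize (l ++ [v]) (l.length + 1) = 1 := by
  rw [fringeSize, Finset.card_eq_one]
  refine ⟨l.length + 1, Finset.ext fun u => ?_⟩
  rw [mem_descSet, Finset.mem_singleton, List.length_append, List.length_singleton]
  refine ⟨fun h => ?_, fun h => ⟨by omega, h ▸ self_mem_anc _ _⟩⟩
  have := le_of_mem_anc h.2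
  omega

lemma fringeSize_pos {l : List ℕ} {x : ℕ} (hx : x ≤ l.length) : 0 < fringeSize l x :=
  Finset.card_pos.2 ⟨x, mem_descSet.2 ⟨by omega, self_mem_anc l x⟩⟩

lemma fringeSize_zero (l : List ℕ) : fringeSize l 0 = l.length + 1 := by
  have : descSet l (l.length + 1) 0 = Finset.range (l.length + 1) := by
    ext u
    simp [mem_descSet, zero_mem_anc]
  rw [fringeSize, this, Finset.card_range]

lemma fringeSize_lt {l : List ℕ} {x y : ℕ} (hx : x ≤ l.length) (hxy : x ∈ anc l y) (hne : x ≠ y) :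
    fringeSize l y < fringeSize l x := by
  refine Finset.card_lt_card (Finset.ssubset_iff_of_subset ?_ |>.2 ⟨x, ?_, ?_⟩)
  · intro u hu
    rw [mem_descSet] at hu ⊢
    exact ⟨hu.1, mem_anc_trans hxy hu.2⟩
  · exact mem_descSet.2 ⟨by omega, self_mem_anc l x⟩
  · intro h
    exact hne (eq_of_mem_anc_of_mem_anc hxy (mem_descSet.1 h).2)

open Classical in
lemma sum_mem_anc (l : List ℕ) (x : ℕ) :
    ∑ y ∈ Finset.range (l.length + 1), (if x ∈ anc l y then (1 : ℝ) else 0) = fringeSize l x := by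
  rw [Finset.sum_boole, fringeSize, descSet]

end FringeSize

section Counts

open Classical in
/-- The number of nodes whose fringe subtree has `k` nodes. -/
noncomputable def fringeCount (l : List ℕ) (k : ℕ) : ℝ :=
  ∑ x ∈ Finset.range (l.length + 1), if fringeSize l x = k then 1 else 0

open Classical in
/-- The number of ancestors of `v` whose fringe subtree has `k` nodes. -/
noncomputable def ancCount (l : List ℕ) (k v : ℕ) : ℝ :=
  ∑ x ∈ Finset.range (l.length + 1), if fringeSize l x = k ∧ x ∈ anc l v then 1 else 0

open Classical in
/-- The number of pairs of nested fringe subtrees with `j` and `k` nodes. -/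
noncomputable def nestedCount (l : List ℕ) (j k : ℕ) : ℝ :=
  ∑ x ∈ Finset.range (l.length + 1), ∑ y ∈ Finset.range (l.length + 1),
    if fringeSize l x = k ∧ fringeSize l y = j ∧ x ∈ anc l y then 1 else 0

open Classical in
/-- The number of pairs of nested fringe subtrees with `j` and `k` nodes of which the larger one
contains `v`. -/
noncomputable def nestedAncCount (l : List ℕ) (j k v : ℕ) : ℝ :=
  ∑ x ∈ Finset.range (l.length + 1), ∑ y ∈ Finset.range (l.length + 1),
    if fringeSize l x = k ∧ fringeSize l y = j ∧ x ∈ anc l y ∧ x ∈ anc l v then 1 else 0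

lemma countSize_eq_fringeCount (l : List ℕ) (k : ℕ) :
    (countSize l (l.length + 1) k : ℝ) = fringeCount l k := by
  rw [fringeCount, Finset.sum_boole, countSize]
  rfl

lemma ancCount_zero (l : List ℕ) (v : ℕ) : ancCount l 0 v = 0 := by
  refine Finset.sum_eq_zero fun x hx => if_neg fun h => ?_
  have := fringeSize_pos (l := l) (x := x) (by simpa [Nat.lt_succ_iff] using hx)
  omega

lemma fringeCount_append {l : List ℕ} {v : ℕ} (hv : v ≤ l.length) (k : ℕ) :
    fringeCount (l ++ [v]) (k + 1) =
      fringeCount l (k + 1) + ancCount l k v - ancCount l (k + 1) v + if k = 0 then 1 else 0 := by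
  rw [fringeCount, List.length_append, List.length_singleton, Finset.sum_range_succ,
    fringeSize_append_length, fringeCount, ancCount, ancCount, ← Finset.sum_add_distrib,
    ← Finset.sum_sub_distrib]
  congr 1
  · refine Finset.sum_congr rfl fun x hx => ?_
    rw [fringeSize_append hv (by simpa [Nat.lt_succ_iff] using hx)]
    by_cases h : x ∈ anc l v
    · simp [h]
    · simp [h]
  · by_cases h : k = 0 <;> simp [h]

lemma ancCount_eq_zero_or_one {l : List ℕ} (k v : ℕ) : ancCount l k v = 0 ∨ ancCount l k v = 1 := by
  classical
  have : ((Finset.range (l.length + 1)).filter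
      (fun x => fringeSize l x = k ∧ x ∈ anc l v)).card ≤ 1 := by
    refine Finset.card_le_one.2 fun x hx y hy => ?_
    simp only [Finset.mem_filter, Finset.mem_range, Nat.lt_succ_iff] at hx hy
    by_contra hne
    rcases mem_anc_total hx.2.2 hy.2.2 with h | h
    · have := fringeSize_lt hx.1 h hne
      omega
    · have := fringeSize_lt hy.1 h (Ne.symm hne)
      omega
  rw [ancCount, Finset.sum_boole]
  interval_cases h : ((Finset.range (l.length + 1)).filter
      (fun x => fringeSize l x = k ∧ x ∈ anc l v)).card
  · left; simp
  · right; simp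

open Classical in
lemma ancCount_mul_ancCount {l : List ℕ} {j k : ℕ} (hjk : j < k) (v : ℕ) :
    ancCount l j v * ancCount l k v =
      ∑ x ∈ Finset.range (l.length + 1), ∑ y ∈ Finset.range (l.length + 1),
        if (fringeSize l x = k ∧ fringeSize l y = j ∧ x ∈ anc l y) ∧ y ∈ anc l v
          then (1 : ℝ) else 0 := by
  rw [ancCount, ancCount, mul_comm, Finset.sum_mul_sum]
  refine Finset.sum_congr rfl fun x hx => Finset.sum_congr rfl fun y hy => ?_
  simp only [Finset.mem_range, Nat.lt_succ_iff] at hx hy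
  rw [ite_zero_mul_ite_zero, one_mul]
  refine if_congr ⟨fun ⟨⟨h1, h2⟩, h3, h4⟩ => ⟨⟨h1, h3, ?_⟩, h4⟩,
    fun ⟨⟨h1, h2, h3⟩, h4⟩ => ⟨⟨h1, mem_anc_trans h3 h4⟩, h2, h4⟩⟩ rfl rfl
  rcases mem_anc_total h2 h4 with h | h
  · exact h
  · by_cases hxy : x = y
    · exact hxy ▸ self_mem_anc l x
    · have := fringeSize_lt hy h (Ne.symm hxy)
      omega

lemma nestedCount_append {l : List ℕ} {v : ℕ} (hv : v ≤ l.length) :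
    nestedCount (l ++ [v]) 2 3 =
      nestedCount l 2 3 + ancCount l 1 v * ancCount l 2 v - nestedAncCount l 2 3 v := by
  classical
  rw [nestedCount, List.length_append, List.length_singleton, Finset.sum_range_succ,
    ancCount_mul_ancCount (by norm_num), nestedCount, nestedAncCount]
  have h1 : ∀ x, (if fringeSize (l ++ [v]) x = 3 ∧ fringeSize (l ++ [v]) (l.length + 1) = 2 ∧
      x ∈ anc (l ++ [v]) (l.length + 1) then (1 : ℝ) else 0) = 0 := fun x =>
    if_neg fun h => by rw [fringeSize_append_length] at h; omega
  have h2 : ∀ y, (if fringeSize (l ++ [v]) (l.length + 1) = 3 ∧ fringeSize (l ++ [v]) y = 2 ∧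
      l.length + 1 ∈ anc (l ++ [v]) y then (1 : ℝ) else 0) = 0 := fun y =>
    if_neg fun h => by rw [fringeSize_append_length] at h; omega
  rw [Finset.sum_eq_zero (fun y _ => h2 y), add_zero]
  simp only [Finset.sum_range_succ _ (l.length + 1), h1, add_zero]
  rw [← Finset.sum_add_distrib, ← Finset.sum_sub_distrib]
  refine Finset.sum_congr rfl fun x hx => ?_
  rw [← Finset.sum_add_distrib, ← Finset.sum_sub_distrib]
  refine Finset.sum_congr rfl fun y hy => ?_
  simp only [Finset.mem_range, Nat.lt_succ_iff] at hx hy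
  rw [fringeSize_append hv hx, fringeSize_append hv hy, anc_append v hy]
  by_cases hxy : x ∈ anc l y
  · have hlt : x ≠ y → fringeSize l y < fringeSize l x := fringeSize_lt hx hxy
    have heq : x = y → fringeSize l y = fringeSize l x := fun h => by rw [h]
    by_cases hyv : y ∈ anc l v
    · simp [hxy, hyv, mem_anc_trans hxy hyv]
    · by_cases hxv : x ∈ anc l v
      · have : ¬ (fringeSize l x = 2 ∧ fringeSize l y = 2) := by
          rintro ⟨h3, h4⟩
          by_cases h : x = y
          · exact hyv (h ▸ hxv)
          · have := hlt h
            omega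
        simp [hxy, hyv, hxv, this]
      · simp [hxy, hyv, hxv]
  · simp [hxy]

lemma nestedAncCount_nonneg (l : List ℕ) (j k v : ℕ) : 0 ≤ nestedAncCount l j k v :=
  Finset.sum_nonneg fun _ _ => Finset.sum_nonneg fun _ _ => by split_ifs <;> norm_num

lemma nestedAncCount_le (l : List ℕ) (j k v : ℕ) : nestedAncCount l j k v ≤ k := by
  classical
  have : nestedAncCount l j k v ≤ ancCount l k v * k := by
    rw [ancCount, Finset.sum_mul]
    refine Finset.sum_le_sum fun x _ => ?_
    by_cases h : fringeSize l x = k ∧ x ∈ anc l v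
    · rw [if_pos h, one_mul, ← h.1, ← sum_mem_anc]
      refine Finset.sum_le_sum fun y _ => ?_
      split_ifs with h1 h2 <;> first | exact absurd h1.2.2.1 h2 | norm_num
    · rw [if_neg h, zero_mul]
      exact (Finset.sum_eq_zero fun y _ => if_neg fun h' => h ⟨h'.1, h'.2.2.2⟩).le
  rcases ancCount_eq_zero_or_one (l := l) k v with h | h <;> rw [h] at this
  · exact this.trans (by simp)
  · simpa using this

lemma nestedCount_one_two (l : List ℕ) : nestedCount l 1 2 = fringeCount l 2 := by
  classical
  refine Finset.sum_congr rfl fun x hx => ?_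
  rw [Finset.mem_range, Nat.lt_succ_iff] at hx
  by_cases h : fringeSize l x = 2
  · have h1 := sum_mem_anc l x
    have h2 : ∑ y ∈ Finset.range (l.length + 1), (if x ∈ anc l y then (1 : ℝ) else 0) =
        ∑ y ∈ Finset.range (l.length + 1),
          ((if fringeSize l x = 2 ∧ fringeSize l y = 1 ∧ x ∈ anc l y then 1 else 0) +
            if y = x then 1 else 0) := by
      refine Finset.sum_congr rfl fun y hy => ?_
      rw [Finset.mem_range, Nat.lt_succ_iff] at hy
      by_cases hxy : x ∈ anc l y
      · by_cases hne : y = x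
        · subst hne; simp [hxy, h]
        · have h3 := fringeSize_lt hx hxy (Ne.symm hne)
          have h4 := fringeSize_pos hy
          have h5 : fringeSize l y = 1 := by omega
          simp [hxy, hne, h5, h]
      · have hne : y ≠ x := fun e => hxy (e ▸ self_mem_anc l x)
        simp [hxy, hne]
    rw [h2, Finset.sum_add_distrib, Finset.sum_ite_eq',
      if_pos (by simpa [Nat.lt_succ_iff] using hx)] at h1
    have h3 : (fringeSize l x : ℝ) = 2 := by exact_mod_cast h
    rw [if_pos h]
    linarith
  · simp [h]

lemma nestedCount_one_three (l : List ℕ) :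
    nestedCount l 1 3 = 2 * fringeCount l 3 - nestedCount l 2 3 := by
  classical
  rw [nestedCount, nestedCount, fringeCount, Finset.mul_sum, ← Finset.sum_sub_distrib]
  refine Finset.sum_congr rfl fun x hx => ?_
  rw [Finset.mem_range, Nat.lt_succ_iff] at hx
  by_cases h : fringeSize l x = 3
  · have h1 := sum_mem_anc l x
    have h2 : ∑ y ∈ Finset.range (l.length + 1), (if x ∈ anc l y then (1 : ℝ) else 0) =
        ∑ y ∈ Finset.range (l.length + 1),
          (((if fringeSize l x = 3 ∧ fringeSize l y = 1 ∧ x ∈ anc l y then 1 else 0) +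
            if fringeSize l x = 3 ∧ fringeSize l y = 2 ∧ x ∈ anc l y then 1 else 0) +
            if y = x then 1 else 0) := by
      refine Finset.sum_congr rfl fun y hy => ?_
      rw [Finset.mem_range, Nat.lt_succ_iff] at hy
      by_cases hxy : x ∈ anc l y
      · by_cases hne : y = x
        · subst hne; simp [hxy, h]
        · have h3 := fringeSize_lt hx hxy (Ne.symm hne)
          have h4 := fringeSize_pos hy
          obtain h5 | h5 : fringeSize l y = 1 ∨ fringeSize l y = 2 := by omega
          all_goals simp [hxy, hne, h5, h]
      · have hne : y ≠ x := fun e => hxy (e ▸ self_mem_anc l x)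
        simp [hxy, hne]
    rw [h2, Finset.sum_add_distrib, Finset.sum_add_distrib, Finset.sum_ite_eq',
      if_pos (by simpa [Nat.lt_succ_iff] using hx)] at h1
    have h3 : (fringeSize l x : ℝ) = 3 := by exact_mod_cast h
    rw [if_pos h]
    linarith
  · simp [h]

end Counts

section Transition

/-- The probability that the next node is attached to `v`, given the parent list `l`. -/
noncomputable def stepProb (χ ρ : ℝ) (l : List ℕ) (v : ℕ) : ℝ :=
  (χ * (l.count v : ℝ) + ρ) / (((l.length : ℝ) + 1) * (χ + ρ) - χ)

/-- The parent lists that occur with positive probability. -/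
inductive Reachable (χ ρ : ℝ) : List ℕ → Prop
  | nil : Reachable χ ρ []
  | snoc {l : List ℕ} {v : ℕ} (hl : Reachable χ ρ l) (hv : v ≤ l.length)
      (hw : 0 < χ * (l.count v : ℝ) + ρ) : Reachable χ ρ (l ++ [v])

variable {χ ρ : ℝ}

lemma Reachable.count_eq_zero {l : List ℕ} (h : Reachable χ ρ l) {v : ℕ} (hv : l.length ≤ v) :
    l.count v = 0 := by
  induction h with
  | nil => simp
  | @snoc l w _ hw _ ih =>
    rw [List.length_append, List.length_singleton] at hv
    rw [List.count_append, ih (by omega), List.count_singleton, if_neg]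
    simp only [beq_iff_eq]
    omega

lemma Reachable.weight_nonneg (hχ : χ = -1 ∨ χ = 0 ∨ χ = 1) (hρ : 0 < ρ)
    (hint : χ = -1 → ∃ m : ℕ, 2 ≤ m ∧ ρ = m) {l : List ℕ} (h : Reachable χ ρ l) (v : ℕ) :
    0 ≤ χ * (l.count v : ℝ) + ρ := by
  rcases hχ with hχ | hχ
  · obtain ⟨m, -, rfl⟩ := hint hχ
    subst hχ
    suffices l.count v ≤ m by
      have : (l.count v : ℝ) ≤ m := by exact_mod_cast this
      linarith
    induction h with
    | nil => simp
    | @snoc l w _ _ hpos ih =>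
      have hpos : (l.count w : ℝ) < m := by linarith
      have hpos : l.count w < m := by exact_mod_cast hpos
      rw [List.count_append, List.count_singleton]
      by_cases hwv : w = v
      · subst hwv
        simpa using hpos
      · simpa [hwv] using ih
  · have : 0 ≤ χ := by rcases hχ with rfl | rfl <;> norm_num
    positivity

lemma Reachable.sum_count {l : List ℕ} (h : Reachable χ ρ l) {x : ℕ} (hx : x ≤ l.length) :
    ∑ v ∈ Finset.range (l.length + 1), (if x ∈ anc l v then (l.count v : ℝ) else 0) =
      fringeSize l x - 1 := by
  classical
  induction h with
  | nil =>
    obtain rfl : x = 0 := by simpa using hx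
    simp [fringeSize_zero]
  | @snoc l w hl hw _ ih =>
    have hc : (l ++ [w]).count (l.length + 1) = 0 := by
      rw [List.count_append, hl.count_eq_zero (by omega), List.count_singleton, if_neg]
      simp only [beq_iff_eq]
      omega
    rw [List.length_append, List.length_singleton, Finset.sum_range_succ, hc, Nat.cast_zero, ite_self,
      add_zero]
    rw [List.length_append, List.length_singleton] at hx
    rcases Nat.lt_or_ge l.length x with hlt | hle
    · obtain rfl : x = l.length + 1 := by omega
      rw [fringeSize_append_length, Nat.cast_one, sub_self]
      refine Finset.sum_eq_zero fun v hv => if_neg fun h => ?_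
      have := le_of_mem_anc h
      rw [Finset.mem_range] at hv
      omega
    · rw [fringeSize_append hw hle]
      have : ∀ v ∈ Finset.range (l.length + 1),
          (if x ∈ anc (l ++ [w]) v then ((l ++ [w]).count v : ℝ) else 0) =
            (if x ∈ anc l v then (l.count v : ℝ) else 0) +
              if v = w then (if x ∈ anc l w then 1 else 0) else 0 := by
        intro v hv
        rw [Finset.mem_range, Nat.lt_succ_iff] at hv
        rw [anc_append w hv, List.count_append, List.count_singleton]
        by_cases hvw : v = w
        · subst hvw
          by_cases hxv : x ∈ anc l v <;> simp [hxv]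
        · simp [hvw, Ne.symm hvw]
      rw [Finset.sum_congr rfl this, Finset.sum_add_distrib, Finset.sum_ite_eq',
        if_pos (by simpa [Nat.lt_succ_iff] using hw), ih hle]
      push_cast
      ring

lemma Reachable.sum_stepProb_anc (hρ : 0 < ρ) (hs : 0 < χ + ρ) {l : List ℕ}
    (h : Reachable χ ρ l) {x : ℕ} (hx : x ≤ l.length) [∀ v, Decidable (x ∈ anc l v)] :
    ∑ v ∈ Finset.range (l.length + 1), stepProb χ ρ l v * (if x ∈ anc l v then 1 else 0) =
      ((fringeSize l x : ℝ) - 1 + ρ / (χ + ρ)) / (l.length + ρ / (χ + ρ)) := by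
  classical
  have h1 : ∑ v ∈ Finset.range (l.length + 1),
      (χ * (l.count v : ℝ) + ρ) * (if x ∈ anc l v then 1 else 0) =
      χ * (fringeSize l x - 1) + ρ * fringeSize l x := by
    rw [← h.sum_count hx, ← sum_mem_anc, Finset.mul_sum, Finset.mul_sum, ← Finset.sum_add_distrib]
    refine Finset.sum_congr rfl fun v _ => ?_
    split_ifs <;> ring
  have h2 : 0 < (l.length : ℝ) * (χ + ρ) + ρ := by positivity
  have h3 : ((l.length : ℝ) + 1) * (χ + ρ) - χ = (l.length : ℝ) * (χ + ρ) + ρ := by ring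
  simp only [stepProb, div_mul_eq_mul_div, ← Finset.sum_div, h1, h3]
  have h4 : (l.length : ℝ) + ρ / (χ + ρ) ≠ 0 := by positivity
  rw [div_eq_div_iff h2.ne' h4]
  field_simp
  ring

lemma Reachable.sum_stepProb (hρ : 0 < ρ) (hs : 0 < χ + ρ) {l : List ℕ} (h : Reachable χ ρ l) :
    ∑ v ∈ Finset.range (l.length + 1), stepProb χ ρ l v = 1 := by
  classical
  have h1 := h.sum_stepProb_anc hρ hs (Nat.zero_le _)
  have h2 : (l.length : ℝ) + ρ / (χ + ρ) ≠ 0 := by positivity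
  simpa [zero_mem_anc, fringeSize_zero, h2] using h1

lemma Reachable.sum_stepProb_ancCount (hρ : 0 < ρ) (hs : 0 < χ + ρ) {l : List ℕ}
    (h : Reachable χ ρ l) (k : ℕ) :
    ∑ v ∈ Finset.range (l.length + 1), stepProb χ ρ l v * ancCount l k v =
      ((k : ℝ) - 1 + ρ / (χ + ρ)) * fringeCount l k / (l.length + ρ / (χ + ρ)) := by
  classical
  simp only [ancCount, fringeCount, Finset.mul_sum, Finset.sum_div]
  rw [Finset.sum_comm]
  refine Finset.sum_congr rfl fun x hx => ?_
  rw [Finset.mem_range, Nat.lt_succ_iff] at hx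
  by_cases hk : fringeSize l x = k
  · simpa [hk] using h.sum_stepProb_anc hρ hs hx
  · simp [hk]

lemma Reachable.sum_stepProb_ancCount_mul (hρ : 0 < ρ) (hs : 0 < χ + ρ) {l : List ℕ}
    (h : Reachable χ ρ l) {j k : ℕ} (hjk : j < k) :
    ∑ v ∈ Finset.range (l.length + 1), stepProb χ ρ l v * (ancCount l j v * ancCount l k v) =
      ((j : ℝ) - 1 + ρ / (χ + ρ)) * nestedCount l j k / (l.length + ρ / (χ + ρ)) := by
  classical
  simp only [ancCount_mul_ancCount hjk, nestedCount, Finset.mul_sum, Finset.sum_div]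
  rw [Finset.sum_comm]
  refine Finset.sum_congr rfl fun x _ => ?_
  rw [Finset.sum_comm]
  refine Finset.sum_congr rfl fun y hy => ?_
  rw [Finset.mem_range, Nat.lt_succ_iff] at hy
  by_cases hk : fringeSize l x = k ∧ fringeSize l y = j ∧ x ∈ anc l y
  · have := h.sum_stepProb_anc hρ hs hy
    rw [hk.2.1] at this
    simpa only [hk, and_self, true_and, if_true, mul_one] using this
  · simp only [hk, false_and, if_false, mul_zero, zero_div, Finset.sum_const_zero]

lemma Reachable.sum_stepProb_nestedAncCount (hρ : 0 < ρ) (hs : 0 < χ + ρ) {l : List ℕ}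
    (h : Reachable χ ρ l) (j k : ℕ) :
    ∑ v ∈ Finset.range (l.length + 1), stepProb χ ρ l v * nestedAncCount l j k v =
      ((k : ℝ) - 1 + ρ / (χ + ρ)) * nestedCount l j k / (l.length + ρ / (χ + ρ)) := by
  classical
  simp only [nestedAncCount, nestedCount, Finset.mul_sum, Finset.sum_div]
  rw [Finset.sum_comm]
  refine Finset.sum_congr rfl fun x hx => ?_
  rw [Finset.sum_comm]
  refine Finset.sum_congr rfl fun y _ => ?_
  rw [Finset.mem_range, Nat.lt_succ_iff] at hx
  by_cases hk : fringeSize l x = k ∧ fringeSize l y = j ∧ x ∈ anc l y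
  · have := h.sum_stepProb_anc hρ hs hx
    rw [hk.1] at this
    simpa only [hk, and_self, true_and, if_true, mul_one] using this
  · have hk' : ∀ v, ¬ (fringeSize l x = k ∧ fringeSize l y = j ∧ x ∈ anc l y ∧ x ∈ anc l v) :=
      fun v hv => hk ⟨hv.1, hv.2.1, hv.2.2.1⟩
    simp only [hk, hk', if_false, mul_zero, zero_div, Finset.sum_const_zero]

end Transition

section Expectation

variable {χ ρ : ℝ}

lemma prob_append (χ ρ : ℝ) (l : List ℕ) (v : ℕ) :
    prob χ ρ (l ++ [v]) = prob χ ρ l * stepProb χ ρ l v := by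
  rw [prob, List.length_append, List.length_singleton, Finset.prod_range_succ, prob, stepProb]
  congr 1
  · refine Finset.prod_congr rfl fun i hi => ?_
    rw [Finset.mem_range] at hi
    rw [List.getD_append _ _ _ _ hi, List.take_append_of_le_length hi.le]
  · simp [List.getD_eq_getElem?_getD]

/-- The expectation of a functional of the parent list after `k` steps. -/
noncomputable def expecList {F : Type*} [AddCommMonoid F] [Module ℝ F] (χ ρ : ℝ) (k : ℕ)
    (f : List ℕ → F) : F :=
  ∑ p : Omega (k + 1), prob χ ρ (toList p) • f (toList p)

lemma length_toList {n : ℕ} (p : Omega n) : (toList p).length = n - 1 := by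
  simp [toList]

/-- Splitting off the last parent. -/
def omegaSnocEquiv (k : ℕ) : Fin (k + 1) × Omega (k + 1) ≃ Omega (k + 2) :=
  Fin.snocEquiv (fun i : Fin (k + 1) => Fin ((i : ℕ) + 1))

lemma toList_snoc {k : ℕ} (v : Fin (k + 1)) (p : Omega (k + 1)) :
    toList (omegaSnocEquiv k (v, p)) = toList p ++ [(v : ℕ)] := by
  change (List.finRange (k + 1)).map _ = (List.finRange k).map _ ++ _
  rw [List.finRange_succ_last, List.map_append, List.map_map, List.map_singleton]
  congr 1
  · refine List.map_congr_left fun i _ => ?_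
    simp [omegaSnocEquiv, Fin.snocEquiv]
  · simp [omegaSnocEquiv, Fin.snocEquiv]

lemma expecList_succ {F : Type*} [AddCommMonoid F] [Module ℝ F] (χ ρ : ℝ) (k : ℕ)
    (f : List ℕ → F) :
    expecList χ ρ (k + 1) f = expecList χ ρ k
      (fun l => ∑ v ∈ Finset.range (l.length + 1), stepProb χ ρ l v • f (l ++ [v])) := by
  rw [expecList, expecList,
    ← (omegaSnocEquiv k).sum_comp, Fintype.sum_prod_type_right]
  refine Finset.sum_congr rfl fun p _ => ?_
  rw [Finset.smul_sum, length_toList, Finset.sum_range]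
  refine Finset.sum_congr rfl fun v _ => ?_
  rw [smul_smul, ← prob_append, ← toList_snoc v p]

lemma expecList_zero {F : Type*} [AddCommMonoid F] [Module ℝ F] (χ ρ : ℝ) (f : List ℕ → F) :
    expecList χ ρ 0 f = f [] := by
  have h : ∀ p : Omega (0 + 1), toList p = [] := fun p => rfl
  simp only [expecList, h, prob]
  simp

lemma toList_reachable_or_prob_eq_zero (hχ : χ = -1 ∨ χ = 0 ∨ χ = 1) (hρ : 0 < ρ)
    (hint : χ = -1 → ∃ m : ℕ, 2 ≤ m ∧ ρ = m) (hs : 0 < χ + ρ) (k : ℕ) (p : Omega (k + 1)) :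
    (Reachable χ ρ (toList p) ∧ 0 < prob χ ρ (toList p)) ∨ prob χ ρ (toList p) = 0 := by
  induction k with
  | zero => exact Or.inl ⟨Reachable.nil, by simp [toList, prob]⟩
  | succ k ih =>
    obtain ⟨⟨v, p⟩, rfl⟩ := (omegaSnocEquiv k).surjective p
    have hts := toList_snoc v p
    rw [hts, prob_append]
    rcases ih p with ⟨hr, hp⟩ | h
    · have hden : 0 < (((toList p).length : ℝ) + 1) * (χ + ρ) - χ := by
        have : 0 < ((toList p).length : ℝ) * (χ + ρ) + ρ := by positivity
        linarith
      rcases (hr.weight_nonneg hχ hρ hint v).lt_or_eq with hw | hw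
      · refine Or.inl ⟨hr.snoc ?_ hw, mul_pos hp (div_pos hw hden)⟩
        rw [length_toList]
        exact Nat.lt_succ_iff.1 v.2
      · right
        rw [stepProb, ← hw, zero_div, mul_zero]
    · right
      rw [h, zero_mul]

end Expectation

section Parameters

/-- The limiting proportion of fringe subtrees with one node. -/
noncomputable def mean1 (κ : ℝ) : ℝ := 1 / (1 + κ)

/-- The limiting proportion of fringe subtrees with two nodes. -/
noncomputable def mean2 (κ : ℝ) : ℝ := κ / ((1 + κ) * (2 + κ))

/-- The limiting proportion of fringe subtrees with three nodes. -/
noncomputable def mean3 (κ : ℝ) : ℝ := κ / ((κ + 2) * (κ + 3))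

/-- The limiting proportion of fringe subtrees that are paths with three nodes. -/
noncomputable def meanPath (κ : ℝ) : ℝ := κ ^ 2 / ((1 + κ) * (2 + κ) * (3 + κ))

/-- The limiting conditional second moment of an increment of the linear statistic with
coefficients `a`, `b`, `c`. -/
noncomputable def stepVar (κ a b c : ℝ) : ℝ :=
  (a - (a * mean1 κ + b * mean2 κ + c * mean3 κ)) ^ 2 +
    (2 * (a - (a * mean1 κ + b * mean2 κ + c * mean3 κ)) * (b - a) + (b - a) ^ 2) *
      (κ * mean1 κ) +
    (2 * (a - (a * mean1 κ + b * mean2 κ + c * mean3 κ)) * (c - b) + (c - b) ^ 2) *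
      ((1 + κ) * mean2 κ) +
    (2 * (a - (a * mean1 κ + b * mean2 κ + c * mean3 κ)) * (-c) + (-c) ^ 2) *
      ((2 + κ) * mean3 κ) +
    2 * (b - a) * (c - b) * (κ * mean2 κ) +
    2 * (b - a) * (-c) * (κ * (2 * mean3 κ - meanPath κ)) +
    2 * (c - b) * (-c) * ((1 + κ) * meanPath κ)

/-- A symmetric bilinear form in three variables, as a function of the entries of its matrix. -/
def bilin3 (s : Fin 6 → ℝ) (a b c a' b' c' : ℝ) : ℝ :=
  s 0 * (a * a') + s 1 * (a * b' + b * a') + s 2 * (b * b') + s 3 * (a * c' + c * a') +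
    s 4 * (b * c' + c * b') + s 5 * (c * c')

lemma abs_bilin3_le (s : Fin 6 → ℝ) {a b c a' b' c' A A' : ℝ} (ha : |a| ≤ A) (hb : |b| ≤ A)
    (hc : |c| ≤ A) (ha' : |a'| ≤ A') (hb' : |b'| ≤ A') (hc' : |c'| ≤ A') :
    |bilin3 s a b c a' b' c'| ≤ 2 * (∑ i, |s i|) * (A * A') := by
  have hA : 0 ≤ A := (abs_nonneg a).trans ha
  have hm : ∀ {x y : ℝ}, |x| ≤ A → |y| ≤ A' → |x * y| ≤ A * A' := fun hx hy => by
    rw [abs_mul]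
    exact mul_le_mul hx hy (abs_nonneg _) hA
  have hAA : 0 ≤ A * A' := (abs_nonneg _).trans (hm ha ha')
  have key : ∀ (i : Fin 6) {z : ℝ}, |z| ≤ 2 * (A * A') → |s i * z| ≤ 2 * |s i| * (A * A') :=
    fun i z hz => by
      rw [abs_mul]
      nlinarith [abs_nonneg (s i)]
  have h2 : ∀ {z w : ℝ}, |z| ≤ A * A' → |w| ≤ A * A' → |z + w| ≤ 2 * (A * A') := fun hz hw =>
    (abs_add_le _ _).trans (by linarith)
  have h1 : ∀ {z : ℝ}, |z| ≤ A * A' → |z| ≤ 2 * (A * A') := fun hz => by linarith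
  have k0 := key 0 (h1 (hm ha ha'))
  have k1 := key 1 (h2 (hm ha hb') (hm hb ha'))
  have k2 := key 2 (h1 (hm hb hb'))
  have k3 := key 3 (h2 (hm ha hc') (hm hc ha'))
  have k4 := key 4 (h2 (hm hb hc') (hm hc hb'))
  have k5 := key 5 (h1 (hm hc hc'))
  rw [Fin.sum_univ_six, bilin3]
  rw [abs_le] at *
  constructor <;> linarith

/-- The limiting covariance matrix solves the Lyapunov equation of the urn. -/
lemma exists_covariance {κ : ℝ} (hκ : 0 < κ) :
    ∃ s : Fin 6 → ℝ, s 5 = sigma3sq κ ∧ ∀ a b c : ℝ,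
      bilin3 s a b c a b c -
        2 * bilin3 s a b c (κ * (b - a)) ((1 + κ) * (c - b)) (-((2 + κ) * c)) =
      stepVar κ a b c := by
  let v := stepVar κ
  obtain ⟨s11, h11⟩ : ∃ s, s = v 1 0 0 / (1 + 2 * κ) := ⟨_, rfl⟩
  obtain ⟨s12, h12⟩ : ∃ s, s = (v 1 1 0 - v 1 0 0 - v 0 1 0 + 2 * κ * s11) / (2 * (2 + 2 * κ)) :=
    ⟨_, rfl⟩
  obtain ⟨s22, h22⟩ : ∃ s, s = (v 0 1 0 + 2 * κ * s12) / (3 + 2 * κ) := ⟨_, rfl⟩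
  obtain ⟨s13, h13⟩ : ∃ s, s = (v 1 0 1 - v 1 0 0 - v 0 0 1 + 2 * (1 + κ) * s12) /
    (2 * (3 + 2 * κ)) := ⟨_, rfl⟩
  obtain ⟨s23, h23⟩ : ∃ s, s = (v 0 1 1 - v 0 1 0 - v 0 0 1 + 2 * κ * s13 + 2 * (1 + κ) * s22) /
    (2 * (4 + 2 * κ)) := ⟨_, rfl⟩
  obtain ⟨s33, h33⟩ : ∃ s, s = (v 0 0 1 + 2 * (1 + κ) * s23) / (5 + 2 * κ) := ⟨_, rfl⟩
  refine ⟨![s11, s12, s22, s13, s23, s33], ?_, fun a b c => ?_⟩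
  · change s33 = _
    rw [h33, h23, h13, h22, h12, h11]
    simp only [v, stepVar, mean1, mean2, mean3, meanPath, sigma3sq]
    field_simp
    ring
  · rw [eq_div_iff (by positivity)] at h11 h12 h22 h13 h23 h33
    simp only [bilin3, v, stepVar, Matrix.cons_val] at *
    linear_combination a ^ 2 * h11 + a * b * h12 + b ^ 2 * h22 + a * c * h13 + b * c * h23 +
      c ^ 2 * h33

end Parameters

section Step

lemma mean_equations {κ : ℝ} (hκ : 0 < κ) :
    mean1 κ * (1 + κ) = 1 ∧ mean2 κ * (2 + κ) = κ * mean1 κ ∧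
      mean3 κ * (3 + κ) = (1 + κ) * mean2 κ ∧ meanPath κ * (3 + κ) = κ * mean2 κ := by
  refine ⟨?_, ?_, ?_, ?_⟩ <;>
  · simp only [mean1, mean2, mean3, meanPath]
    field_simp
    try ring

lemma mean_bounds {κ : ℝ} (hκ : 0 < κ) :
    (0 ≤ mean1 κ ∧ mean1 κ ≤ 1) ∧ (0 ≤ mean2 κ ∧ mean2 κ ≤ 1) ∧ (0 ≤ mean3 κ ∧ mean3 κ ≤ 1) ∧
      (0 ≤ meanPath κ ∧ meanPath κ ≤ 1) := by
  obtain ⟨h1, h2, h3, h4⟩ := mean_equations hκ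
  have p1 : 0 ≤ mean1 κ := by unfold mean1; positivity
  have p2 : 0 ≤ mean2 κ := by unfold mean2; positivity
  have p3 : 0 ≤ mean3 κ := by unfold mean3; positivity
  have p4 : 0 ≤ meanPath κ := by unfold meanPath; positivity
  have b1 : mean1 κ ≤ 1 := by nlinarith
  have b2 : mean2 κ ≤ 1 := by nlinarith
  have b3 : mean3 κ ≤ 1 := by nlinarith
  have b4 : meanPath κ ≤ 1 := by nlinarith
  exact ⟨⟨p1, b1⟩, ⟨p2, b2⟩, ⟨p3, b3⟩, p4, b4⟩

/-- The joint law of the indicators that the node chosen by one growth step lies in a fringe subtree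
with one, two or three nodes, and of the number `K` of destroyed paths: `q` are the attachment
probabilities, `N` is the normalized total weight, and `x₁`, `x₂`, `x₃`, `xp` are the centered
counts. -/
structure StepLaw (κ N x₁ x₂ x₃ xp : ℝ) (s : Finset ℕ) (q I₁ I₂ I₃ K : ℕ → ℝ) : Prop where
  q_nonneg : ∀ v, 0 ≤ q v
  q_sum : ∑ v ∈ s, q v = 1
  I₁_mem : ∀ v, I₁ v = 0 ∨ I₁ v = 1
  I₂_mem : ∀ v, I₂ v = 0 ∨ I₂ v = 1
  I₃_mem : ∀ v, I₃ v = 0 ∨ I₃ v = 1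
  K_nonneg : ∀ v, 0 ≤ K v
  K_le : ∀ v, K v ≤ 3
  sum_I₁ : ∑ v ∈ s, q v * I₁ v = κ * (mean1 κ + x₁ / N)
  sum_I₂ : ∑ v ∈ s, q v * I₂ v = (1 + κ) * (mean2 κ + x₂ / N)
  sum_I₃ : ∑ v ∈ s, q v * I₃ v = (2 + κ) * (mean3 κ + x₃ / N)
  sum_K : ∑ v ∈ s, q v * K v = (2 + κ) * (meanPath κ + xp / N)
  sum_I₁₂ : ∑ v ∈ s, q v * (I₁ v * I₂ v) = κ * (mean2 κ + x₂ / N)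
  sum_I₁₃ : ∑ v ∈ s, q v * (I₁ v * I₃ v) =
    κ * (2 * (mean3 κ + x₃ / N) - (meanPath κ + xp / N))
  sum_I₂₃ : ∑ v ∈ s, q v * (I₂ v * I₃ v) = (1 + κ) * (meanPath κ + xp / N)

lemma sum_mul_sq_add_le {s : Finset ℕ} {q d : ℕ → ℝ} (hq : ∀ v, 0 ≤ q v) (hs : ∑ v ∈ s, q v = 1)
    {B : ℝ} (hd : ∀ v, |d v| ≤ B) (x : ℝ) :
    ∑ v ∈ s, q v * (x + d v) ^ 2 ≤ x ^ 2 + 2 * x * ∑ v ∈ s, q v * d v + B ^ 2 := by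
  have h : x ^ 2 + 2 * x * ∑ v ∈ s, q v * d v + B ^ 2 =
      ∑ v ∈ s, q v * (x ^ 2 + 2 * x * d v + B ^ 2) := by
    simp only [mul_add, Finset.sum_add_distrib, ← Finset.sum_mul, hs, one_mul, Finset.mul_sum]
    congr 2
    exact Finset.sum_congr rfl fun v _ => by ring
  rw [h]
  refine Finset.sum_le_sum fun v _ => mul_le_mul_of_nonneg_left ?_ (hq v)
  nlinarith [sq_le_sq.2 ((hd v).trans (le_abs_self B))]

namespace StepLaw

variable {κ N x₁ x₂ x₃ xp : ℝ} {s : Finset ℕ} {q I₁ I₂ I₃ K : ℕ → ℝ}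

lemma sum_sq_le (h : StepLaw κ N x₁ x₂ x₃ xp s q I₁ I₂ I₃ K) (hκ : 0 < κ) (hκ2 : κ ≤ 2)
    (hN : 0 < N) :
    ∑ v ∈ s, q v * ((x₁ + (1 - I₁ v - mean1 κ)) ^ 2 + (x₂ + (I₁ v - I₂ v - mean2 κ)) ^ 2 +
      (x₃ + (I₂ v - I₃ v - mean3 κ)) ^ 2 + (xp + (I₁ v * I₂ v - K v - meanPath κ)) ^ 2) ≤
      x₁ ^ 2 + x₂ ^ 2 + x₃ ^ 2 + xp ^ 2 + 40 := by
  obtain ⟨e1, e2, e3, e4⟩ := mean_equations hκ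
  obtain ⟨⟨p1, b1⟩, ⟨p2, b2⟩, ⟨p3, b3⟩, p4, b4⟩ := mean_bounds hκ
  have d1 : ∀ v, |1 - I₁ v - mean1 κ| ≤ 2 := fun v => by
    rw [abs_le]; rcases h.I₁_mem v with h1 | h1 <;> rw [h1] <;> constructor <;> linarith
  have d2 : ∀ v, |I₁ v - I₂ v - mean2 κ| ≤ 2 := fun v => by
    rw [abs_le]
    rcases h.I₁_mem v with h1 | h1 <;> rcases h.I₂_mem v with h2 | h2 <;> rw [h1, h2] <;>
      constructor <;> linarith
  have d3 : ∀ v, |I₂ v - I₃ v - mean3 κ| ≤ 2 := fun v => by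
    rw [abs_le]
    rcases h.I₂_mem v with h1 | h1 <;> rcases h.I₃_mem v with h2 | h2 <;> rw [h1, h2] <;>
      constructor <;> linarith
  have d4 : ∀ v, |I₁ v * I₂ v - K v - meanPath κ| ≤ 5 := fun v => by
    have := h.K_nonneg v
    have := h.K_le v
    rw [abs_le]
    rcases h.I₁_mem v with h1 | h1 <;> rcases h.I₂_mem v with h2 | h2 <;> rw [h1, h2] <;>
      constructor <;> linarith
  have s1 := sum_mul_sq_add_le h.q_nonneg h.q_sum d1 x₁
  have s2 := sum_mul_sq_add_le h.q_nonneg h.q_sum d2 x₂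
  have s3 := sum_mul_sq_add_le h.q_nonneg h.q_sum d3 x₃
  have s4 := sum_mul_sq_add_le h.q_nonneg h.q_sum d4 xp
  simp only [mul_sub, mul_one, Finset.sum_sub_distrib, ← Finset.sum_mul, h.q_sum, one_mul, h.sum_I₁,
    h.sum_I₂, h.sum_I₃, h.sum_K, h.sum_I₁₂] at s1 s2 s3 s4
  simp only [mul_add, Finset.sum_add_distrib] at s1 s2 s3 s4 ⊢
  have hneg : (x₁ * (-κ * x₁) + x₂ * (κ * x₁ - (1 + κ) * x₂) +
      x₃ * ((1 + κ) * x₂ - (2 + κ) * x₃) + xp * (κ * x₂ - (2 + κ) * xp)) / N ≤ 0 := by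
    refine div_nonpos_of_nonpos_of_nonneg ?_ hN.le
    nlinarith [mul_nonneg hκ.le (sq_nonneg x₁), mul_nonneg hκ.le (sq_nonneg (x₁ - x₂)),
      mul_nonneg hκ.le (sq_nonneg (x₂ - x₃)), sq_nonneg (x₂ - x₃), sq_nonneg (x₂ - κ * xp),
      mul_nonneg hκ.le (sq_nonneg x₃), sq_nonneg x₃,
      mul_nonneg (show 0 ≤ 4 + 2 * κ - κ ^ 2 by nlinarith) (sq_nonneg xp)]
  have hexp : (x₁ * (-κ * x₁) + x₂ * (κ * x₁ - (1 + κ) * x₂) +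
      x₃ * ((1 + κ) * x₂ - (2 + κ) * x₃) + xp * (κ * x₂ - (2 + κ) * xp)) / N =
      x₁ * (-κ * (x₁ / N)) + x₂ * (κ * (x₁ / N) - (1 + κ) * (x₂ / N)) +
      x₃ * ((1 + κ) * (x₂ / N) - (2 + κ) * (x₃ / N)) +
      xp * (κ * (x₂ / N) - (2 + κ) * (xp / N)) := by ring
  rw [hexp] at hneg
  have g1 : 2 * x₁ * (1 - κ * mean1 κ - mean1 κ) = 0 := by linear_combination -2 * x₁ * e1
  have g2 : 2 * x₂ * (κ * mean1 κ - (1 + κ) * mean2 κ - mean2 κ) = 0 := by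
    linear_combination -2 * x₂ * e2
  have g3 : 2 * x₃ * ((1 + κ) * mean2 κ - (2 + κ) * mean3 κ - mean3 κ) = 0 := by
    linear_combination -2 * x₃ * e3
  have g4 : 2 * xp * (κ * mean2 κ - (2 + κ) * meanPath κ - meanPath κ) = 0 := by
    linear_combination -2 * xp * e4
  linarith

/-- The linear statistic of the increment of the centered counts. -/
noncomputable def incr (κ : ℝ) (I₁ I₂ I₃ : ℕ → ℝ) (a b c : ℝ) (v : ℕ) : ℝ :=
  a * (1 - I₁ v - mean1 κ) + b * (I₁ v - I₂ v - mean2 κ) + c * (I₂ v - I₃ v - mean3 κ)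

lemma abs_incr_le (h : StepLaw κ N x₁ x₂ x₃ xp s q I₁ I₂ I₃ K) (hκ : 0 < κ) {a b c : ℝ}
    (ha : |a| ≤ 1) (hb : |b| ≤ 1) (hc : |c| ≤ 1) (v : ℕ) : |incr κ I₁ I₂ I₃ a b c v| ≤ 6 := by
  obtain ⟨⟨p1, b1⟩, ⟨p2, b2⟩, ⟨p3, b3⟩, -⟩ := mean_bounds hκ
  have key : ∀ {y z : ℝ}, |y| ≤ 1 → |z| ≤ 2 → |y * z| ≤ 2 := fun hy hz => by
    rw [abs_mul]
    nlinarith [abs_nonneg ‹ℝ›]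
  have d1 : |1 - I₁ v - mean1 κ| ≤ 2 := by
    rw [abs_le]; rcases h.I₁_mem v with h1 | h1 <;> rw [h1] <;> constructor <;> linarith
  have d2 : |I₁ v - I₂ v - mean2 κ| ≤ 2 := by
    rw [abs_le]
    rcases h.I₁_mem v with h1 | h1 <;> rcases h.I₂_mem v with h2 | h2 <;> rw [h1, h2] <;>
      constructor <;> linarith
  have d3 : |I₂ v - I₃ v - mean3 κ| ≤ 2 := by
    rw [abs_le]
    rcases h.I₂_mem v with h1 | h1 <;> rcases h.I₃_mem v with h2 | h2 <;> rw [h1, h2] <;>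
      constructor <;> linarith
  have k1 := key ha d1
  have k2 := key hb d2
  have k3 := key hc d3
  rw [incr]
  rw [abs_le] at *
  constructor <;> linarith

lemma sum_incr (h : StepLaw κ N x₁ x₂ x₃ xp s q I₁ I₂ I₃ K) (hκ : 0 < κ) (a b c : ℝ) :
    ∑ v ∈ s, q v * incr κ I₁ I₂ I₃ a b c v =
      (κ * (b - a) * x₁ + (1 + κ) * (c - b) * x₂ - (2 + κ) * c * x₃) / N := by
  obtain ⟨e1, e2, e3, -⟩ := mean_equations hκ
  have : ∀ v, q v * incr κ I₁ I₂ I₃ a b c v =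
      q v * (a - (a * mean1 κ + b * mean2 κ + c * mean3 κ)) + q v * I₁ v * (b - a) +
        q v * I₂ v * (c - b) + q v * I₃ v * (-c) := fun v => by rw [incr]; ring
  simp only [this, Finset.sum_add_distrib, ← Finset.sum_mul, h.q_sum, h.sum_I₁, h.sum_I₂, h.sum_I₃]
  linear_combination -a * e1 - b * e2 - c * e3

lemma sum_incr_sq (h : StepLaw κ N x₁ x₂ x₃ xp s q I₁ I₂ I₃ K) {a b c A : ℝ}
    (hA : A = a - (a * mean1 κ + b * mean2 κ + c * mean3 κ)) :
    ∑ v ∈ s, q v * incr κ I₁ I₂ I₃ a b c v ^ 2 = stepVar κ a b c +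
      ((b - a) * (2 * A + (b - a)) * κ * x₁ +
        ((c - b) * (2 * A + (c - b)) * (1 + κ) + 2 * ((b - a) * (c - b)) * κ) * x₂ +
        (-c * (2 * A + -c) * (2 + κ) + 4 * ((b - a) * (-c)) * κ) * x₃ +
        (2 * ((c - b) * (-c)) * (1 + κ) - 2 * ((b - a) * (-c)) * κ) * xp) / N := by
  have i1 : ∀ v, I₁ v ^ 2 = I₁ v := fun v => by
    rcases h.I₁_mem v with h | h <;> rw [h] <;> norm_num
  have i2 : ∀ v, I₂ v ^ 2 = I₂ v := fun v => by
    rcases h.I₂_mem v with h | h <;> rw [h] <;> norm_num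
  have i3 : ∀ v, I₃ v ^ 2 = I₃ v := fun v => by
    rcases h.I₃_mem v with h | h <;> rw [h] <;> norm_num
  have : ∀ v, q v * incr κ I₁ I₂ I₃ a b c v ^ 2 =
      q v * A ^ 2 + q v * I₁ v * (2 * A * (b - a) + (b - a) ^ 2) +
        q v * I₂ v * (2 * A * (c - b) + (c - b) ^ 2) + q v * I₃ v * (2 * A * (-c) + (-c) ^ 2) +
        q v * (I₁ v * I₂ v) * (2 * (b - a) * (c - b)) +
        q v * (I₁ v * I₃ v) * (2 * (b - a) * (-c)) +
        q v * (I₂ v * I₃ v) * (2 * (c - b) * (-c)) := fun v => by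
    rw [incr, hA]
    linear_combination q v * (b - a) ^ 2 * i1 v + q v * (c - b) ^ 2 * i2 v + q v * c ^ 2 * i3 v
  simp only [this, Finset.sum_add_distrib, ← Finset.sum_mul, h.q_sum, h.sum_I₁, h.sum_I₂, h.sum_I₃,
    h.sum_I₁₂, h.sum_I₁₃, h.sum_I₂₃, stepVar, ← hA]
  ring

lemma abs_sum_incr_sq_sub_le (h : StepLaw κ N x₁ x₂ x₃ xp s q I₁ I₂ I₃ K) (hκ : 0 < κ)
    (hκ2 : κ ≤ 2) (hN : 0 < N) {a b c : ℝ} (ha : |a| ≤ 1) (hb : |b| ≤ 1) (hc : |c| ≤ 1) :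
    |∑ v ∈ s, q v * incr κ I₁ I₂ I₃ a b c v ^ 2 - stepVar κ a b c| ≤
      100 * (|x₁| + |x₂| + |x₃| + |xp|) / N := by
  obtain ⟨⟨p1, b1⟩, ⟨p2, b2⟩, ⟨p3, b3⟩, -⟩ := mean_bounds hκ
  obtain ⟨A, hA⟩ : ∃ A, A = a - (a * mean1 κ + b * mean2 κ + c * mean3 κ) := ⟨_, rfl⟩
  rw [h.sum_incr_sq hA, add_sub_cancel_left, abs_div, abs_of_pos hN]
  refine div_le_div_of_nonneg_right ?_ hN.le
  have hm : ∀ {y z Y Z : ℝ}, |y| ≤ Y → |z| ≤ Z → |y * z| ≤ Y * Z := fun hy hz => by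
    rw [abs_mul]
    exact mul_le_mul hy hz (abs_nonneg _) ((abs_nonneg _).trans hy)
  have hp : ∀ {y z Y Z : ℝ}, |y| ≤ Y → |z| ≤ Z → |y + z| ≤ Y + Z := fun hy hz =>
    (abs_add_le _ _).trans (add_le_add hy hz)
  have hs : ∀ {y z Y Z : ℝ}, |y| ≤ Y → |z| ≤ Z → |y - z| ≤ Y + Z := fun hy hz =>
    (abs_sub _ _).trans (add_le_add hy hz)
  have m1 : |mean1 κ| ≤ 1 := abs_le.2 ⟨by linarith, b1⟩
  have m2 : |mean2 κ| ≤ 1 := abs_le.2 ⟨by linarith, b2⟩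
  have m3 : |mean3 κ| ≤ 1 := abs_le.2 ⟨by linarith, b3⟩
  have hA4 : |2 * A| ≤ 8 := by
    have := hs ha (hp (hp (hm ha m1) (hm hb m2)) (hm hc m3))
    rw [hA, abs_mul, abs_two]
    linarith
  have hx := hs hb ha
  have hy := hs hc hb
  have hz : |-c| ≤ 1 := by rwa [abs_neg]
  have k0 : |κ| ≤ 2 := abs_le.2 ⟨by linarith, hκ2⟩
  have k1 : |1 + κ| ≤ 3 := abs_le.2 ⟨by linarith, by linarith⟩
  have k2 : |2 + κ| ≤ 4 := abs_le.2 ⟨by linarith, by linarith⟩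
  have t2 : |(2 : ℝ)| ≤ 2 := abs_two.le
  have t4 : |(4 : ℝ)| ≤ 4 := (abs_of_pos (by norm_num)).le
  have f1 := hm (hm (hm hx (hp hA4 hx)) k0) (le_refl |x₁|)
  have f2 := hm (hp (hm (hm hy (hp hA4 hy)) k1) (hm (hm t2 (hm hx hy)) k0)) (le_refl |x₂|)
  have f3 := hm (hp (hm (hm hz (hp hA4 hz)) k2) (hm (hm t4 (hm hx hz)) k0)) (le_refl |x₃|)
  have f4 := hm (hs (hm (hm t2 (hm hy hz)) k1) (hm (hm t2 (hm hx hz)) k0)) (le_refl |xp|)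
  refine (hp (hp (hp f1 f2) f3) f4).trans ?_
  nlinarith [abs_nonneg x₁, abs_nonneg x₂, abs_nonneg x₃, abs_nonneg xp]

end StepLaw
end Step

section CharFun

open Complex in
lemma norm_cexp_mul_I_sub_le {y : ℝ} (hy : |y| ≤ 1) :
    ‖cexp (y * I) - (1 + y * I - (y : ℂ) ^ 2 / 2)‖ ≤ |y| ^ 3 := by
  have hn : ‖(y : ℂ) * I‖ = |y| := by simp
  have h := Complex.exp_bound (x := y * I) (by rwa [hn]) (n := 3) (by norm_num)
  rw [hn] at h
  have hs : ∑ m ∈ Finset.range 3, ((y : ℂ) * I) ^ m / (m.factorial : ℂ) =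
      1 + y * I - (y : ℂ) ^ 2 / 2 := by
    simp only [Finset.sum_range_succ, Finset.sum_range_zero, mul_pow, I_sq]
    norm_num [Nat.factorial]
    ring
  rw [hs] at h
  refine h.trans ?_
  have : 0 ≤ |y| ^ 3 := by positivity
  norm_num [Nat.factorial]
  linarith

open Complex in
/-- Second order expansion of the characteristic function of a bounded centered variable. -/
lemma norm_sum_cexp_sub_le {s : Finset ℕ} {q U : ℕ → ℝ} (hq : ∀ v, 0 ≤ q v)
    (hs : ∑ v ∈ s, q v = 1) (hU : ∑ v ∈ s, q v * U v = 0) {B r d : ℝ} (hB : ∀ v, |U v| ≤ B)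
    (hr : |r| * B ≤ 1) (hd : |d| ≤ 1) :
    ‖∑ v ∈ s, (q v : ℂ) * cexp ((r * U v : ℝ) * I) - cexp (-d : ℝ)‖ ≤
      |d - r ^ 2 / 2 * ∑ v ∈ s, q v * U v ^ 2| + (|r| * B) ^ 3 + d ^ 2 := by
  have hrU : ∀ v, |r * U v| ≤ |r| * B := fun v => by
    rw [abs_mul]
    exact mul_le_mul_of_nonneg_left (hB v) (abs_nonneg r)
  have h1 : ‖∑ v ∈ s, (q v : ℂ) * cexp ((r * U v : ℝ) * I) -
      (1 - ((r ^ 2 / 2 * ∑ v ∈ s, q v * U v ^ 2 : ℝ) : ℂ))‖ ≤ (|r| * B) ^ 3 := by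
    have e : (1 - ((r ^ 2 / 2 * ∑ v ∈ s, q v * U v ^ 2 : ℝ) : ℂ)) =
        ∑ v ∈ s, (q v : ℂ) * (1 + (r * U v : ℝ) * I - ((r * U v : ℝ) : ℂ) ^ 2 / 2) := by
      have hs' : ∑ v ∈ s, (q v : ℂ) = 1 := by exact_mod_cast hs
      have hU' : ∑ v ∈ s, (q v : ℂ) * (U v : ℂ) = 0 := by exact_mod_cast hU
      have : ∀ v, (q v : ℂ) * (1 + (r * U v : ℝ) * I - ((r * U v : ℝ) : ℂ) ^ 2 / 2) =
          (q v : ℂ) + (q v * U v) * (r * I) - (r : ℂ) ^ 2 / 2 * (q v * U v ^ 2) := fun v => by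
        push_cast; ring
      simp only [this, Finset.sum_sub_distrib, Finset.sum_add_distrib, ← Finset.sum_mul, hs', hU',
        ← Finset.mul_sum]
      push_cast
      ring
    rw [e, ← Finset.sum_sub_distrib]
    refine (norm_sum_le _ _).trans ?_
    calc _ ≤ ∑ v ∈ s, q v * (|r| * B) ^ 3 := Finset.sum_le_sum fun v _ => by
          rw [← mul_sub, norm_mul, Complex.norm_real, Real.norm_of_nonneg (hq v)]
          refine mul_le_mul_of_nonneg_left ?_ (hq v)
          refine (norm_cexp_mul_I_sub_le ((hrU v).trans hr)).trans ?_
          exact pow_le_pow_left₀ (abs_nonneg _) (hrU v) 3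
      _ = (|r| * B) ^ 3 := by rw [← Finset.sum_mul, hs, one_mul]
  have h2 : ‖cexp (-d : ℝ) - (1 - (d : ℂ))‖ ≤ d ^ 2 := by
    have := Complex.norm_exp_sub_one_sub_id_le (x := ((-d : ℝ) : ℂ))
      (by rwa [Complex.norm_real, Real.norm_eq_abs, abs_neg])
    rw [Complex.norm_real, Real.norm_eq_abs, abs_neg, sq_abs] at this
    convert this using 2
    push_cast
    ring
  have h3 : ‖(1 - ((r ^ 2 / 2 * ∑ v ∈ s, q v * U v ^ 2 : ℝ) : ℂ)) - (1 - (d : ℂ))‖ =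
      |d - r ^ 2 / 2 * ∑ v ∈ s, q v * U v ^ 2| := by
    rw [← Real.norm_eq_abs, ← Complex.norm_real]
    congr 1
    push_cast
    ring
  calc _ ≤ ‖∑ v ∈ s, (q v : ℂ) * cexp ((r * U v : ℝ) * I) -
        (1 - ((r ^ 2 / 2 * ∑ v ∈ s, q v * U v ^ 2 : ℝ) : ℂ))‖ +
      ‖(1 - ((r ^ 2 / 2 * ∑ v ∈ s, q v * U v ^ 2 : ℝ) : ℂ)) - (1 - (d : ℂ))‖ +
      ‖cexp (-d : ℝ) - (1 - (d : ℂ))‖ := by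
        rw [norm_sub_rev (cexp (-d : ℝ))]
        refine le_trans (le_of_eq ?_) (norm_add₃_le)
        congr 1
        ring
    _ ≤ _ := by rw [h3]; linarith

open Complex in
lemma norm_sum_cexp_sub_cexp_le {s : Finset ℕ} {q D : ℕ → ℝ} (hq : ∀ v, 0 ≤ q v)
    (hs : ∑ v ∈ s, q v = 1) {m : ℝ} (hm : ∑ v ∈ s, q v * D v = m) {B r g g' y : ℝ}
    (hB : ∀ v, |D v| ≤ B) (hr : |r| * (2 * B) ≤ 1) (hd : |g' - g| ≤ 1) :
    ‖∑ v ∈ s, (q v : ℂ) * cexp (g' + (r * (y + D v) : ℝ) * I) -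
        cexp (g + (r * (y + m) : ℝ) * I)‖ ≤
      Real.exp g' * (|g' - g - r ^ 2 / 2 * (∑ v ∈ s, q v * D v ^ 2 - m ^ 2)| +
        (|r| * (2 * B)) ^ 3 + (g' - g) ^ 2) := by
  have hmB : |m| ≤ B := by
    rw [← hm]
    refine (Finset.abs_sum_le_sum_abs _ _).trans ?_
    calc _ ≤ ∑ v ∈ s, q v * B := Finset.sum_le_sum fun v _ => by
          rw [abs_mul, abs_of_nonneg (hq v)]
          exact mul_le_mul_of_nonneg_left (hB v) (hq v)
      _ = B := by rw [← Finset.sum_mul, hs, one_mul]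
  have hU : ∑ v ∈ s, q v * (D v - m) = 0 := by
    simp only [mul_sub, Finset.sum_sub_distrib, ← Finset.sum_mul, hs, hm, one_mul, sub_self]
  have hU2 : ∑ v ∈ s, q v * (D v - m) ^ 2 = ∑ v ∈ s, q v * D v ^ 2 - m ^ 2 := by
    have : ∀ v, q v * (D v - m) ^ 2 = q v * D v ^ 2 - q v * D v * (2 * m) + q v * m ^ 2 :=
      fun v => by ring
    simp only [this, Finset.sum_sub_distrib, Finset.sum_add_distrib, ← Finset.sum_mul, hs, hm]
    ring
  have h := norm_sum_cexp_sub_le hq hs hU (B := 2 * B) (r := r) (d := g' - g)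
    (fun v => (abs_sub _ _).trans (by linarith [hB v])) hr hd
  rw [hU2] at h
  have e : ∑ v ∈ s, (q v : ℂ) * cexp (g' + (r * (y + D v) : ℝ) * I) -
      cexp (g + (r * (y + m) : ℝ) * I) = cexp (g' + (r * (y + m) : ℝ) * I) *
        (∑ v ∈ s, (q v : ℂ) * cexp ((r * (D v - m) : ℝ) * I) - cexp (-(g' - g) : ℝ)) := by
    rw [mul_sub, Finset.mul_sum, ← Complex.exp_add]
    congr 1
    · refine Finset.sum_congr rfl fun v _ => ?_
      rw [mul_left_comm, ← Complex.exp_add]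
      congr 2
      push_cast
      ring
    · congr 1
      push_cast
      ring
  rw [e, norm_mul, Complex.norm_exp]
  refine mul_le_mul (le_of_eq ?_) h (norm_nonneg _) (Real.exp_pos _).le
  simp

lemma abs_drift_le {κ a b c : ℝ} (hκ : 0 < κ) (hκ2 : κ ≤ 2) (ha : |a| ≤ 1) (hb : |b| ≤ 1)
    (hc : |c| ≤ 1) :
    |κ * (b - a)| ≤ 6 ∧ |(1 + κ) * (c - b)| ≤ 6 ∧ |-((2 + κ) * c)| ≤ 6 := by
  have h1 : |b - a| ≤ 2 := (abs_sub _ _).trans (by linarith)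
  have h2 : |c - b| ≤ 2 := (abs_sub _ _).trans (by linarith)
  refine ⟨?_, ?_, ?_⟩
  · rw [abs_mul, abs_of_pos hκ]
    nlinarith [abs_nonneg (b - a)]
  · rw [abs_mul, abs_of_pos (by linarith)]
    nlinarith [abs_nonneg (c - b)]
  · rw [abs_neg, abs_mul, abs_of_pos (by linarith)]
    nlinarith [abs_nonneg c]

/-- The change in one growth step of the quadratic form with coefficient vector `σ`. -/
lemma abs_bilin3_gap_sub_le {κ N M u : ℝ} (hκ : 0 < κ) (hκ2 : κ ≤ 2) {σ : Fin 6 → ℝ}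
    (hσ : ∀ a b c : ℝ, bilin3 σ a b c a b c -
      2 * bilin3 σ a b c (κ * (b - a)) ((1 + κ) * (c - b)) (-((2 + κ) * c)) = stepVar κ a b c)
    (hM : ∑ i, |σ i| = M) {a b c : ℝ} (ha : |a| ≤ 1) (hb : |b| ≤ 1) (hc : |c| ≤ 1)
    (hu : 0 < u) (hu1 : u ≤ 1) (huN : u ^ 2 * N = 1) :
    |(N + 1) * bilin3 σ a b c a b c - N * bilin3 σ (a + κ * (b - a) / N)
        (b + (1 + κ) * (c - b) / N) (c + -((2 + κ) * c) / N) (a + κ * (b - a) / N)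
        (b + (1 + κ) * (c - b) / N) (c + -((2 + κ) * c) / N) - stepVar κ a b c| ≤ 72 * M * u ∧
      |stepVar κ a b c| ≤ 26 * M := by
  have hN : 0 < N := pos_of_mul_pos_right (huN ▸ one_pos) (sq_nonneg u)
  obtain ⟨hB1, hB2, hB3⟩ := abs_drift_le hκ hκ2 ha hb hc
  have hM0 : 0 ≤ M := hM ▸ Finset.sum_nonneg fun i _ => abs_nonneg _
  constructor
  · have hR := abs_bilin3_le σ hB1 hB2 hB3 hB1 hB2 hB3
    obtain ⟨R, hR'⟩ : ∃ R, R = bilin3 σ (κ * (b - a)) ((1 + κ) * (c - b)) (-((2 + κ) * c))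
      (κ * (b - a)) ((1 + κ) * (c - b)) (-((2 + κ) * c)) := ⟨_, rfl⟩
    rw [← hR', hM] at hR
    have hu2 : u ^ 2 ≤ u := by nlinarith
    calc _ = |-(R * u ^ 2)| := by
          congr 1
          have : u ^ 2 = 1 / N := by rw [eq_div_iff hN.ne', huN]
          rw [this, ← hσ, hR']
          unfold bilin3
          field_simp
          ring
      _ = |R| * u ^ 2 := by rw [abs_neg, abs_mul, abs_of_nonneg (sq_nonneg u)]
      _ ≤ 72 * M * u := mul_le_mul (by linarith) hu2 (sq_nonneg u) (by positivity)
  · have h1 := abs_bilin3_le σ ha hb hc ha hb hc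
    have h2 := abs_bilin3_le σ ha hb hc hB1 hB2 hB3
    rw [hM] at h1 h2
    rw [← hσ]
    refine (abs_sub _ _).trans ?_
    rw [abs_mul, abs_two]
    linarith

lemma sq_drift_le {κ a b c x₁ x₂ x₃ u m : ℝ} (hκ : 0 < κ) (hκ2 : κ ≤ 2) (ha : |a| ≤ 1)
    (hb : |b| ≤ 1) (hc : |c| ≤ 1) (hu : 0 < u) (hu1 : u ≤ 1)
    (hm : m = (κ * (b - a) * x₁ + (1 + κ) * (c - b) * x₂ - (2 + κ) * c * x₃) * u ^ 2) :
    m ^ 2 ≤ 108 * ((x₁ ^ 2 + x₂ ^ 2 + x₃ ^ 2) * u ^ 3) := by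
  obtain ⟨hB1, hB2, hB3⟩ := abs_drift_le hκ hκ2 ha hb hc
  have e1 : |m| ≤ 6 * (|x₁| + |x₂| + |x₃|) * u ^ 2 := by
    rw [hm, abs_mul, abs_of_nonneg (sq_nonneg u)]
    refine mul_le_mul_of_nonneg_right ?_ (sq_nonneg u)
    have f1 : |κ * (b - a) * x₁| ≤ 6 * |x₁| := by
      rw [abs_mul]; exact mul_le_mul_of_nonneg_right hB1 (abs_nonneg _)
    have f2 : |(1 + κ) * (c - b) * x₂| ≤ 6 * |x₂| := by
      rw [abs_mul]; exact mul_le_mul_of_nonneg_right hB2 (abs_nonneg _)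
    have f3 : |(2 + κ) * c * x₃| ≤ 6 * |x₃| := by
      rw [abs_neg] at hB3
      rw [abs_mul]; exact mul_le_mul_of_nonneg_right hB3 (abs_nonneg _)
    refine (abs_sub _ _).trans ?_
    linarith [abs_add_le (κ * (b - a) * x₁) ((1 + κ) * (c - b) * x₂)]
  have e2 : (|x₁| + |x₂| + |x₃|) ^ 2 ≤ 3 * (x₁ ^ 2 + x₂ ^ 2 + x₃ ^ 2) := by
    rw [← sq_abs x₁, ← sq_abs x₂, ← sq_abs x₃]
    nlinarith [sq_nonneg (|x₁| - |x₂|), sq_nonneg (|x₁| - |x₃|), sq_nonneg (|x₂| - |x₃|)]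
  have e3 : u ^ 4 ≤ u ^ 3 := pow_le_pow_of_le_one hu.le hu1 (by norm_num)
  calc m ^ 2 = |m| ^ 2 := (sq_abs m).symm
    _ ≤ (6 * (|x₁| + |x₂| + |x₃|) * u ^ 2) ^ 2 := pow_le_pow_left₀ (abs_nonneg m) e1 2
    _ = 36 * (|x₁| + |x₂| + |x₃|) ^ 2 * u ^ 4 := by ring
    _ ≤ 36 * (3 * (x₁ ^ 2 + x₂ ^ 2 + x₃ ^ 2)) * u ^ 3 :=
      mul_le_mul (by linarith) e3 (by positivity) (by positivity)
    _ = _ := by ring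

lemma sum_abs_mul_sq_le (x₁ x₂ x₃ xp : ℝ) {u : ℝ} (hu : 0 < u) :
    (|x₁| + |x₂| + |x₃| + |xp|) * u ^ 2 ≤
      (x₁ ^ 2 + x₂ ^ 2 + x₃ ^ 2 + xp ^ 2) * u ^ 3 / 2 + 2 * u := by
  have hx : ∀ x : ℝ, |x| * u ^ 2 ≤ (x ^ 2 * u ^ 3 + u) / 2 := fun x => by
    have : 0 ≤ u * (|x| * u - 1) ^ 2 := by positivity
    rw [← sq_abs x]
    linarith
  linarith [hx x₁, hx x₂, hx x₃, hx xp]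

lemma expansion_error_le {M τ T u r G V W m : ℝ} (hM : 0 ≤ M) (hu : 0 < u) (hT : 0 ≤ T)
    (hru : |r| ≤ τ * u) (hr : |r| ≤ 1) (hGV : |G - V| ≤ 72 * M * u) (hG : |G| ≤ 98 * M)
    (hW : |W - V| ≤ 50 * T + 200 * u) (hm : m ^ 2 ≤ 108 * T) :
    |r ^ 2 / 2 * G - r ^ 2 / 2 * (W - m ^ 2)| + (|r| * (2 * 6)) ^ 3 + (r ^ 2 / 2 * G) ^ 2 ≤
      r ^ 2 * (200 + 36 * M + 1728 * τ + 2401 * M ^ 2 * τ) * (T + u) := by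
  have hτ : 0 ≤ τ := nonneg_of_mul_nonneg_left ((abs_nonneg r).trans hru) hu
  have hfirst : |r ^ 2 / 2 * G - r ^ 2 / 2 * (W - m ^ 2)| ≤
      r ^ 2 * (36 * M * u + 79 * T + 100 * u) := by
    have : r ^ 2 / 2 * G - r ^ 2 / 2 * (W - m ^ 2) = r ^ 2 / 2 * ((G - V) - (W - V) + m ^ 2) := by
      ring
    rw [this, abs_mul, abs_of_nonneg (by positivity)]
    have : |(G - V) - (W - V) + m ^ 2| ≤ 2 * (36 * M * u + 79 * T + 100 * u) := by
      refine (abs_add_le _ _).trans ?_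
      rw [abs_of_nonneg (sq_nonneg m)]
      linarith [abs_sub (G - V) (W - V)]
    calc _ ≤ r ^ 2 / 2 * (2 * (36 * M * u + 79 * T + 100 * u)) :=
          mul_le_mul_of_nonneg_left this (by positivity)
      _ = _ := by ring
  have hcube : (|r| * (2 * 6)) ^ 3 ≤ r ^ 2 * (1728 * τ * u) := by
    calc (|r| * (2 * 6)) ^ 3 = 1728 * (|r| ^ 2 * |r|) := by ring
      _ = 1728 * (r ^ 2 * |r|) := by rw [sq_abs]
      _ ≤ 1728 * (r ^ 2 * (τ * u)) := by gcongr
      _ = _ := by ring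
  have hsq : (r ^ 2 / 2 * G) ^ 2 ≤ r ^ 2 * (2401 * M ^ 2 * τ * u) := by
    have hr2 : r ^ 2 ≤ τ * u := by
      rw [← sq_abs]
      nlinarith [abs_nonneg r]
    calc (r ^ 2 / 2 * G) ^ 2 = r ^ 2 / 4 * |G| ^ 2 * r ^ 2 := by rw [sq_abs]; ring
      _ ≤ r ^ 2 / 4 * (98 * M) ^ 2 * (τ * u) := by gcongr
      _ = _ := by ring
  have hfin : 0 ≤ r ^ 2 * (121 * T + 100 * u + (36 * M + 1728 * τ + 2401 * M ^ 2 * τ) * T) := by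
    positivity
  linarith

namespace StepLaw

variable {κ N x₁ x₂ x₃ xp : ℝ} {s : Finset ℕ} {q I₁ I₂ I₃ K : ℕ → ℝ}

open Complex in
/-- One step of the characteristic function recursion: growing the tree by one node corresponds, up
to an error of order `r ^ 2 * u` on average, to replacing the coefficients `a, b, c` by
`a', b', c'`. -/
lemma norm_sum_cexp_incr_sub_le (h : StepLaw κ N x₁ x₂ x₃ xp s q I₁ I₂ I₃ K) (hκ : 0 < κ)
    (hκ2 : κ ≤ 2) {σ : Fin 6 → ℝ}
    (hσ : ∀ a b c : ℝ, bilin3 σ a b c a b c -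
      2 * bilin3 σ a b c (κ * (b - a)) ((1 + κ) * (c - b)) (-((2 + κ) * c)) = stepVar κ a b c)
    {M : ℝ} (hM : ∑ i, |σ i| = M) {a b c a' b' c' : ℝ}
    (ha : |a| ≤ 1) (hb : |b| ≤ 1) (hc : |c| ≤ 1)
    (ha' : a' = a + κ * (b - a) / N) (hb' : b' = b + (1 + κ) * (c - b) / N)
    (hc' : c' = c + -((2 + κ) * c) / N)
    {u r τ : ℝ} (hu : 0 < u) (hu1 : u ≤ 1) (huN : u ^ 2 * N = 1) (hru : |r| ≤ τ * u)
    (hr : 12 * |r| ≤ 1) (hrM : 49 * M * r ^ 2 ≤ 1) :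
    ‖∑ v ∈ s, (q v : ℂ) * cexp ((r ^ 2 / 2 * ((N + 1) * bilin3 σ a b c a b c) : ℝ) +
          (r * (a * x₁ + b * x₂ + c * x₃ + incr κ I₁ I₂ I₃ a b c v) : ℝ) * I) -
        cexp ((r ^ 2 / 2 * (N * bilin3 σ a' b' c' a' b' c') : ℝ) +
          (r * (a' * x₁ + b' * x₂ + c' * x₃) : ℝ) * I)‖ ≤
      Real.exp (r ^ 2 * (N + 1) * M) * (r ^ 2 * (200 + 36 * M + 1728 * τ + 2401 * M ^ 2 * τ) *
        ((x₁ ^ 2 + x₂ ^ 2 + x₃ ^ 2 + xp ^ 2) * u ^ 3 + u)) := by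
  have hN : 0 < N := pos_of_mul_pos_right (huN ▸ one_pos) (sq_nonneg u)
  have hNu : ∀ z : ℝ, z / N = z * u ^ 2 := fun z => by
    rw [div_eq_iff hN.ne', mul_assoc, huN, mul_one]
  have hM0 : 0 ≤ M := hM ▸ Finset.sum_nonneg fun i _ => abs_nonneg _
  obtain ⟨m, hm⟩ : ∃ m, m = (κ * (b - a) * x₁ + (1 + κ) * (c - b) * x₂ - (2 + κ) * c * x₃) / N :=
    ⟨_, rfl⟩
  obtain ⟨hGV, hV⟩ := abs_bilin3_gap_sub_le hκ hκ2 hσ hM ha hb hc hu hu1 huN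
  rw [← ha', ← hb', ← hc'] at hGV
  have hQ := abs_bilin3_le σ ha hb hc ha hb hc
  rw [hM] at hQ
  generalize bilin3 σ a b c a b c = Q at *
  generalize bilin3 σ a' b' c' a' b' c' = Q' at *
  have hy : a' * x₁ + b' * x₂ + c' * x₃ = a * x₁ + b * x₂ + c * x₃ + m := by
    rw [hm, ha', hb', hc']
    ring
  have hL := h.abs_sum_incr_sq_sub_le hκ hκ2 hN ha hb hc
  generalize stepVar κ a b c = V at *
  have hG : |(N + 1) * Q - N * Q'| ≤ 98 * M := by
    have h1 : 72 * M * u ≤ 72 * M := mul_le_of_le_one_right (by positivity) hu1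
    have h2 := abs_add_le ((N + 1) * Q - N * Q' - V) V
    rw [sub_add_cancel] at h2
    linarith
  have hd : |r ^ 2 / 2 * ((N + 1) * Q) - r ^ 2 / 2 * (N * Q')| ≤ 1 := by
    rw [← mul_sub, abs_mul, abs_of_nonneg (by positivity)]
    calc _ ≤ r ^ 2 / 2 * (98 * M) := mul_le_mul_of_nonneg_left hG (by positivity)
      _ ≤ 1 := by linarith
  have hmain := norm_sum_cexp_sub_cexp_le h.q_nonneg h.q_sum ((h.sum_incr hκ a b c).trans hm.symm)
    (r := r) (y := a * x₁ + b * x₂ + c * x₃) (h.abs_incr_le hκ ha hb hc) (by linarith) hd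
  rw [hy]
  refine hmain.trans (mul_le_mul (Real.exp_le_exp.2 ?_) ?_ (by positivity) (Real.exp_pos _).le)
  · have : Q ≤ 2 * M := (le_abs_self Q).trans (by linarith)
    calc _ ≤ r ^ 2 / 2 * ((N + 1) * (2 * M)) := by gcongr
      _ = _ := by ring
  · rw [hNu] at hm hL
    have hx := sum_abs_mul_sq_le x₁ x₂ x₃ xp hu
    have hp : 0 ≤ xp ^ 2 * u ^ 3 := by positivity
    rw [← mul_sub]
    exact expansion_error_le hM0 hu (by positivity) hru (by linarith [abs_nonneg r]) hGV hG
      (by linarith) ((sq_drift_le hκ hκ2 ha hb hc hu hu1 hm).trans (by linarith))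

end StepLaw
end CharFun

section Law

/-- The parameters `χ`, `ρ` allowed for the linear preferential attachment tree. -/
structure Admissible (χ ρ : ℝ) : Prop where
  slope_eq : χ = -1 ∨ χ = 0 ∨ χ = 1
  pos : 0 < ρ
  exists_nat : χ = -1 → ∃ m : ℕ, 2 ≤ m ∧ ρ = m

/-- The number of fringe subtrees with one node, centered. -/
noncomputable def dev1 (κ : ℝ) (l : List ℕ) : ℝ := fringeCount l 1 - mean1 κ * (l.length + κ)

/-- The number of fringe subtrees with two nodes, centered. -/
noncomputable def dev2 (κ : ℝ) (l : List ℕ) : ℝ := fringeCount l 2 - mean2 κ * (l.length + κ)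

/-- The number of fringe subtrees with three nodes, centered. -/
noncomputable def dev3 (κ : ℝ) (l : List ℕ) : ℝ := fringeCount l 3 - mean3 κ * (l.length + κ)

/-- The number of fringe subtrees that are paths with three nodes, centered. -/
noncomputable def devPath (κ : ℝ) (l : List ℕ) : ℝ :=
  nestedCount l 2 3 - meanPath κ * (l.length + κ)

/-- The sum of the squares of the centered counts. -/
noncomputable def devSq (κ : ℝ) (l : List ℕ) : ℝ :=
  dev1 κ l ^ 2 + dev2 κ l ^ 2 + dev3 κ l ^ 2 + devPath κ l ^ 2

section Append

variable (κ : ℝ) {l : List ℕ} {v : ℕ}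

lemma dev1_append (hv : v ≤ l.length) :
    dev1 κ (l ++ [v]) = dev1 κ l + (1 - ancCount l 1 v - mean1 κ) := by
  have := fringeCount_append hv 0
  rw [ancCount_zero, if_pos rfl] at this
  rw [dev1, dev1, List.length_append, List.length_singleton, this]
  push_cast
  ring

lemma dev2_append (hv : v ≤ l.length) :
    dev2 κ (l ++ [v]) = dev2 κ l + (ancCount l 1 v - ancCount l 2 v - mean2 κ) := by
  have := fringeCount_append hv 1
  rw [if_neg one_ne_zero] at this
  rw [dev2, dev2, List.length_append, List.length_singleton, this]
  push_cast
  ring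

lemma dev3_append (hv : v ≤ l.length) :
    dev3 κ (l ++ [v]) = dev3 κ l + (ancCount l 2 v - ancCount l 3 v - mean3 κ) := by
  have := fringeCount_append hv 2
  rw [if_neg two_ne_zero] at this
  rw [dev3, dev3, List.length_append, List.length_singleton, this]
  push_cast
  ring

lemma devPath_append (hv : v ≤ l.length) :
    devPath κ (l ++ [v]) = devPath κ l +
      (ancCount l 1 v * ancCount l 2 v - nestedAncCount l 2 3 v - meanPath κ) := by
  rw [devPath, devPath, List.length_append, List.length_singleton, nestedCount_append hv]
  push_cast
  ring

end Append

section

variable {F : Type*} [AddCommGroup F] [Module ℝ F] (χ ρ : ℝ) (k : ℕ) (f g : List ℕ → F)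

lemma expecList_add : expecList χ ρ k (fun l => f l + g l) =
    expecList χ ρ k f + expecList χ ρ k g := by
  simp only [expecList, smul_add, Finset.sum_add_distrib]

lemma expecList_sub : expecList χ ρ k (fun l => f l - g l) =
    expecList χ ρ k f - expecList χ ρ k g := by
  simp only [expecList, smul_sub, Finset.sum_sub_distrib]

end

namespace Admissible

variable {χ ρ : ℝ}

lemma add_pos (h : Admissible χ ρ) : 0 < χ + ρ := by
  rcases h.slope_eq with hχ | hχ | hχ
  · obtain ⟨m, hm, hρ⟩ := h.exists_nat hχ
    have : (2 : ℝ) ≤ m := by exact_mod_cast hm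
    linarith
  · linarith [h.pos]
  · linarith [h.pos]

lemma ratio_pos (h : Admissible χ ρ) : 0 < ρ / (χ + ρ) := div_pos h.pos h.add_pos

lemma ratio_le_two (h : Admissible χ ρ) : ρ / (χ + ρ) ≤ 2 := by
  rw [div_le_iff₀ h.add_pos]
  rcases h.slope_eq with hχ | hχ | hχ
  · obtain ⟨m, hm, hρ⟩ := h.exists_nat hχ
    have : (2 : ℝ) ≤ m := by exact_mod_cast hm
    linarith
  · linarith [h.pos]
  · linarith [h.pos]

lemma stepLaw (h : Admissible χ ρ) {κ : ℝ} (hκ : ρ / (χ + ρ) = κ) {l : List ℕ}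
    (hl : Reachable χ ρ l) :
    StepLaw κ (l.length + κ) (dev1 κ l) (dev2 κ l) (dev3 κ l) (devPath κ l)
      (Finset.range (l.length + 1)) (stepProb χ ρ l) (ancCount l 1) (ancCount l 2) (ancCount l 3)
      (nestedAncCount l 2 3) := by
  have hs := h.add_pos
  have hκ0 : 0 < κ := hκ ▸ h.ratio_pos
  have hN : (l.length : ℝ) + κ ≠ 0 := by positivity
  have hdiv : ∀ m y : ℝ, m + (y - m * (l.length + κ)) / (l.length + κ) = y / (l.length + κ) :=
    fun m y => by field_simp; ring
  refine ⟨fun v => ?_, hl.sum_stepProb h.pos hs, ancCount_eq_zero_or_one 1,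
    ancCount_eq_zero_or_one 2, ancCount_eq_zero_or_one 3, nestedAncCount_nonneg l 2 3,
    fun v => ?_, ?_, ?_, ?_, ?_, ?_, ?_, ?_⟩
  · refine div_nonneg (hl.weight_nonneg h.slope_eq h.pos h.exists_nat v) ?_
    have h1 : 0 ≤ (l.length : ℝ) * (χ + ρ) := by positivity
    linarith [h.pos]
  · exact_mod_cast nestedAncCount_le l 2 3 v
  · rw [hl.sum_stepProb_ancCount h.pos hs, hκ, dev1, hdiv]
    push_cast
    ring
  · rw [hl.sum_stepProb_ancCount h.pos hs, hκ, dev2, hdiv]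
    push_cast
    ring
  · rw [hl.sum_stepProb_ancCount h.pos hs, hκ, dev3, hdiv]
    push_cast
    ring
  · rw [hl.sum_stepProb_nestedAncCount h.pos hs, hκ, devPath, hdiv]
    push_cast
    ring
  · rw [hl.sum_stepProb_ancCount_mul h.pos hs (by norm_num), hκ, dev2, hdiv, nestedCount_one_two]
    push_cast
    ring
  · rw [hl.sum_stepProb_ancCount_mul h.pos hs (by norm_num), hκ, dev3, devPath, hdiv, hdiv,
      nestedCount_one_three]
    push_cast
    ring
  · rw [hl.sum_stepProb_ancCount_mul h.pos hs (by norm_num), hκ, devPath, hdiv]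
    push_cast
    ring

lemma prob_nonneg (h : Admissible χ ρ) (k : ℕ) (p : Omega (k + 1)) : 0 ≤ prob χ ρ (toList p) := by
  rcases toList_reachable_or_prob_eq_zero h.slope_eq h.pos h.exists_nat h.add_pos k p with hp | hp
  · exact hp.2.le
  · exact hp.ge

lemma norm_expecList_le (h : Admissible χ ρ) {F : Type*} [NormedAddCommGroup F] [NormedSpace ℝ F]
    (k : ℕ) {f : List ℕ → F} {g : List ℕ → ℝ}
    (hfg : ∀ l, Reachable χ ρ l → l.length = k → ‖f l‖ ≤ g l) :
    ‖expecList χ ρ k f‖ ≤ expecList χ ρ k g := by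
  refine (norm_sum_le _ _).trans (Finset.sum_le_sum fun p _ => ?_)
  rw [norm_smul, Real.norm_of_nonneg (h.prob_nonneg k p), smul_eq_mul]
  rcases toList_reachable_or_prob_eq_zero h.slope_eq h.pos h.exists_nat h.add_pos k p with hp | hp
  · exact mul_le_mul_of_nonneg_left (hfg _ hp.1 (length_toList p)) hp.2.le
  · rw [hp, zero_mul, zero_mul]

lemma expecList_mono (h : Admissible χ ρ) (k : ℕ) {f g : List ℕ → ℝ}
    (hfg : ∀ l, Reachable χ ρ l → l.length = k → f l ≤ g l) :
    expecList χ ρ k f ≤ expecList χ ρ k g := by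
  refine Finset.sum_le_sum fun p _ => ?_
  rw [smul_eq_mul, smul_eq_mul]
  rcases toList_reachable_or_prob_eq_zero h.slope_eq h.pos h.exists_nat h.add_pos k p with hp | hp
  · exact mul_le_mul_of_nonneg_left (hfg _ hp.1 (length_toList p)) hp.2.le
  · rw [hp, zero_mul, zero_mul]

lemma sum_prob (h : Admissible χ ρ) (k : ℕ) : ∑ p : Omega (k + 1), prob χ ρ (toList p) = 1 := by
  have key : expecList χ ρ k (fun _ => (1 : ℝ)) = 1 := by
    induction k with
    | zero => exact expecList_zero χ ρ _
    | succ k ih =>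
      rw [expecList_succ]
      refine Eq.trans ?_ ih
      refine le_antisymm (h.expecList_mono k fun l hl _ => ?_)
        (h.expecList_mono k fun l hl _ => ?_) <;>
      simp [hl.sum_stepProb h.pos h.add_pos]
  simpa [expecList] using key

lemma expecList_const (h : Admissible χ ρ) {F : Type*} [AddCommGroup F] [Module ℝ F] (k : ℕ)
    (c : F) : expecList χ ρ k (fun _ => c) = c := by
  rw [expecList, ← Finset.sum_smul, h.sum_prob, one_smul]

lemma expecList_devSq_le (h : Admissible χ ρ) {κ : ℝ} (hκ : ρ / (χ + ρ) = κ) (k : ℕ) :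
    expecList χ ρ k (devSq κ) ≤ (devSq κ [] + 40) * (k + 1) := by
  have hκ0 : 0 < κ := hκ ▸ h.ratio_pos
  have hκ2 : κ ≤ 2 := hκ ▸ h.ratio_le_two
  have h0 : 0 ≤ devSq κ [] := by unfold devSq; positivity
  induction k with
  | zero =>
    rw [expecList_zero]
    simp
  | succ k ih =>
    have hstep : expecList χ ρ (k + 1) (devSq κ) ≤ expecList χ ρ k (fun l => devSq κ l + 40) := by
      rw [expecList_succ]
      refine h.expecList_mono k fun l hl _ => ?_
      refine le_trans (Finset.sum_congr rfl fun v hv => ?_).le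
        ((h.stepLaw hκ hl).sum_sq_le hκ0 hκ2 (by positivity))
      rw [Finset.mem_range, Nat.lt_succ_iff] at hv
      rw [smul_eq_mul, devSq, dev1_append κ hv, dev2_append κ hv, dev3_append κ hv,
        devPath_append κ hv]
    have hadd : expecList χ ρ k (fun l => devSq κ l + 40) = expecList χ ρ k (devSq κ) + 40 := by
      rw [expecList_add, h.expecList_const]
    push_cast
    linarith

end Admissible

end Law

section Recursion

open Complex in
/-- The exponential of the linear statistic with coefficients `r * a`, `r * b`, `r * c`, normalized
by its approximate characteristic function. -/
noncomputable def wave (κ : ℝ) (σ : Fin 6 → ℝ) (r a b c : ℝ) (l : List ℕ) : ℂ :=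
  cexp ((r ^ 2 / 2 * ((l.length + κ) * bilin3 σ a b c a b c) : ℝ) +
    (r * (a * dev1 κ l + b * dev2 κ l + c * dev3 κ l) : ℝ) * I)

variable {χ ρ κ M : ℝ} {σ : Fin 6 → ℝ}

lemma abs_add_mul_sub_div_le {x y w N : ℝ} (hw : 0 ≤ w) (hN : 0 < N) (hwN : w ≤ N)
    (hx : |x| ≤ 1) (hy : |y| ≤ 1) : |x + w * (y - x) / N| ≤ 1 := by
  have h0 : 0 ≤ w / N := by positivity
  have h1 : w / N ≤ 1 := div_le_one_of_le₀ hwN hN.le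
  have e : x + w * (y - x) / N = (1 - w / N) * x + w / N * y := by ring
  rw [e, abs_le]
  rw [abs_le] at hx hy
  constructor <;> nlinarith

lemma Admissible.norm_expecList_wave_succ_sub_le (h : Admissible χ ρ) (hκ : ρ / (χ + ρ) = κ)
    (hσ : ∀ a b c : ℝ, bilin3 σ a b c a b c -
      2 * bilin3 σ a b c (κ * (b - a)) ((1 + κ) * (c - b)) (-((2 + κ) * c)) = stepVar κ a b c)
    (hM : ∑ i, |σ i| = M) {r τ : ℝ} (hτ : 0 ≤ τ) (hr : (12 + 49 * M) * |r| ≤ 1) {k : ℕ}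
    (hk : 1 ≤ k) (hrk : r ^ 2 * (k + κ + 1) ≤ τ ^ 2) {a b c : ℝ}
    (ha : |a| ≤ 1) (hb : |b| ≤ 1) (hc : |c| ≤ 1) :
    ‖expecList χ ρ (k + 1) (wave κ σ r a b c) - expecList χ ρ k (wave κ σ r
        (a + κ * (b - a) / (k + κ)) (b + (1 + κ) * (c - b) / (k + κ))
        (c + -((2 + κ) * c) / (k + κ)))‖ ≤
      Real.exp (τ ^ 2 * M) * (200 + 36 * M + 1728 * τ + 2401 * M ^ 2 * τ) *
        (2 * (devSq κ [] + 40) + 1) * (r ^ 2 / √k) := by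
  have hκ0 : 0 < κ := hκ ▸ h.ratio_pos
  have hκ2 : κ ≤ 2 := hκ ▸ h.ratio_le_two
  have hM0 : 0 ≤ M := hM ▸ Finset.sum_nonneg fun i _ => abs_nonneg _
  have hk' : (1 : ℝ) ≤ k := by exact_mod_cast hk
  have hN : 0 < (k : ℝ) + κ := by positivity
  obtain ⟨u, hu⟩ : ∃ u, u = 1 / √((k : ℝ) + κ) := ⟨_, rfl⟩
  have hu0 : 0 < u := by rw [hu]; positivity
  have huN : u ^ 2 * (k + κ) = 1 := by
    rw [hu, div_pow, Real.sq_sqrt hN.le, one_pow, one_div_mul_cancel hN.ne']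
  have hu1 : u ≤ 1 := by nlinarith
  have huk : u ≤ 1 / √k := by
    rw [hu]
    exact one_div_le_one_div_of_le (by positivity) (Real.sqrt_le_sqrt (by linarith))
  have hr0 := abs_nonneg r
  have hru : |r| ≤ τ * u := by
    refine abs_le_of_sq_le_sq ?_ (by positivity)
    calc r ^ 2 = r ^ 2 * (k + κ) * u ^ 2 := by linear_combination -r ^ 2 * huN
      _ ≤ τ ^ 2 * u ^ 2 := by
        refine mul_le_mul_of_nonneg_right (le_trans ?_ hrk) (sq_nonneg u)
        nlinarith [sq_nonneg r]
      _ = _ := by ring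
  have hrM : 0 ≤ M * |r| := by positivity
  have hr1 : |r| ≤ 1 := by linarith
  have hrM2 : 49 * M * r ^ 2 ≤ 1 := by
    rw [← sq_abs]
    nlinarith
  obtain ⟨A, hA⟩ : ∃ A, A = 200 + 36 * M + 1728 * τ + 2401 * M ^ 2 * τ := ⟨_, rfl⟩
  have hA0 : 0 ≤ A := by rw [hA]; positivity
  have hS : 0 ≤ devSq κ [] := by unfold devSq; positivity
  rw [expecList_succ, ← expecList_sub, ← hA]
  calc _ ≤ expecList χ ρ k (fun l => Real.exp (τ ^ 2 * M) * (r ^ 2 * A * u ^ 3) * devSq κ l +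
        Real.exp (τ ^ 2 * M) * (r ^ 2 * A * u)) := by
        refine h.norm_expecList_le k fun l hl hlk => ?_
        have hstep := (h.stepLaw hκ hl).norm_sum_cexp_incr_sub_le hκ0 hκ2 hσ hM ha hb hc rfl rfl
          rfl hu0 hu1 (by rw [hlk, huN]) hru (by linarith) hrM2
        rw [← hA] at hstep
        refine le_trans (le_of_eq ?_) (hstep.trans ?_)
        · rw [hlk, wave, hlk]
          congr 2
          refine Finset.sum_congr rfl fun v hv => ?_
          rw [Finset.mem_range, Nat.lt_succ_iff, ← hlk] at hv
          rw [Complex.real_smul, wave, dev1_append κ hv, dev2_append κ hv, dev3_append κ hv,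
            List.length_append, List.length_singleton, StepLaw.incr, hlk]
          congr 2
          push_cast
          ring
        · rw [hlk]
          calc _ ≤ Real.exp (τ ^ 2 * M) * (r ^ 2 * A * (devSq κ l * u ^ 3 + u)) := by
                rw [devSq]
                gcongr
            _ = _ := by ring
    _ = Real.exp (τ ^ 2 * M) * (r ^ 2 * A * u ^ 3) * expecList χ ρ k (devSq κ) +
        Real.exp (τ ^ 2 * M) * (r ^ 2 * A * u) := by
        rw [expecList_add, h.expecList_const]
        simp only [expecList, Finset.mul_sum, smul_eq_mul, mul_left_comm]
    _ ≤ Real.exp (τ ^ 2 * M) * (r ^ 2 * A * u ^ 3) * ((devSq κ [] + 40) * (k + 1)) +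
        Real.exp (τ ^ 2 * M) * (r ^ 2 * A * u) := by
        gcongr
        exact h.expecList_devSq_le hκ k
    _ = Real.exp (τ ^ 2 * M) * A * (u ^ 2 * (k + 1) * (devSq κ [] + 40) + 1) * (r ^ 2 * u) := by
        ring
    _ ≤ Real.exp (τ ^ 2 * M) * A * (2 * (devSq κ [] + 40) + 1) * (r ^ 2 * (1 / √k)) := by
        have : u ^ 2 * (k + 1) ≤ 2 := by nlinarith [sq_nonneg u]
        gcongr
    _ = _ := by rw [mul_one_div]

lemma fringeCount_mem_Icc (l : List ℕ) (k : ℕ) :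
    fringeCount l k ∈ Set.Icc (0 : ℝ) (l.length + 1) := by
  classical
  rw [fringeCount]
  refine ⟨Finset.sum_nonneg fun x _ => by split_ifs <;> norm_num, ?_⟩
  refine (Finset.sum_le_card_nsmul _ _ (1 : ℝ) fun x _ => by split_ifs <;> norm_num).trans ?_
  simp

open Complex in
lemma norm_wave_sub_one_le (hκ0 : 0 < κ) (hκ2 : κ ≤ 2) (hM : ∑ i, |σ i| = M) {r : ℝ}
    (hr : (12 + 49 * M) * |r| ≤ 1) {l : List ℕ} (hl : l.length = 2) {a b c : ℝ}
    (ha : |a| ≤ 1) (hb : |b| ≤ 1) (hc : |c| ≤ 1) :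
    ‖wave κ σ r a b c l - 1‖ ≤ 2 * (12 + 4 * M) * |r| := by
  have hM0 : 0 ≤ M := hM ▸ Finset.sum_nonneg fun i _ => abs_nonneg _
  obtain ⟨⟨p1, b1⟩, ⟨p2, b2⟩, ⟨p3, b3⟩, -⟩ := mean_bounds hκ0
  have hr0 := abs_nonneg r
  have hrM : 0 ≤ M * |r| := by positivity
  have hlen : (l.length : ℝ) = 2 := by exact_mod_cast hl
  have hdev : ∀ {m : ℝ} (k : ℕ), 0 ≤ m → m ≤ 1 → |fringeCount l k - m * (l.length + κ)| ≤ 4 := by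
    intro m k hm0 hm1
    obtain ⟨f0, f1⟩ := fringeCount_mem_Icc l k
    rw [hlen] at f1 ⊢
    rw [abs_le]
    constructor <;> nlinarith
  have hprod : ∀ {x y : ℝ}, |x| ≤ 1 → |y| ≤ 4 → |x * y| ≤ 4 := fun {x y} hx hy => by
    rw [abs_mul]
    nlinarith [abs_nonneg x, abs_nonneg y]
  have hlin : |a * dev1 κ l + b * dev2 κ l + c * dev3 κ l| ≤ 12 := by
    have k1 : |a * dev1 κ l| ≤ 4 := hprod ha (hdev 1 p1 b1)
    have k2 : |b * dev2 κ l| ≤ 4 := hprod hb (hdev 2 p2 b2)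
    have k3 : |c * dev3 κ l| ≤ 4 := hprod hc (hdev 3 p3 b3)
    exact (abs_add_three _ _ _).trans (by linarith)
  have hQ := abs_bilin3_le σ ha hb hc ha hb hc
  rw [hM] at hQ
  have hz : ‖((r ^ 2 / 2 * ((l.length + κ) * bilin3 σ a b c a b c) : ℝ) : ℂ) +
      (r * (a * dev1 κ l + b * dev2 κ l + c * dev3 κ l) : ℝ) * I‖ ≤ (12 + 4 * M) * |r| := by
    refine (norm_add_le _ _).trans ?_
    rw [norm_mul, norm_I, mul_one, norm_real, norm_real, Real.norm_eq_abs, Real.norm_eq_abs,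
      abs_mul, abs_mul, abs_mul, hlen, abs_of_nonneg (by positivity : 0 ≤ r ^ 2 / 2),
      abs_of_nonneg (by positivity : 0 ≤ 2 + κ)]
    have h1 : r ^ 2 / 2 * ((2 + κ) * |bilin3 σ a b c a b c|) ≤ |r| / 2 * (4 * (2 * M)) := by
      have : r ^ 2 ≤ |r| := by
        rw [← sq_abs]
        nlinarith
      gcongr
      · linarith
      · linarith
    have h2 : |r| * |a * dev1 κ l + b * dev2 κ l + c * dev3 κ l| ≤ |r| * 12 := by gcongr
    linarith
  refine (Complex.norm_exp_sub_one_le (hz.trans (by linarith))).trans ?_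
  linarith

/-- The normalized characteristic function stays close to `1`. -/
lemma Admissible.norm_expecList_wave_sub_one_le (h : Admissible χ ρ) (hκ : ρ / (χ + ρ) = κ)
    (hσ : ∀ a b c : ℝ, bilin3 σ a b c a b c -
      2 * bilin3 σ a b c (κ * (b - a)) ((1 + κ) * (c - b)) (-((2 + κ) * c)) = stepVar κ a b c)
    (hM : ∑ i, |σ i| = M) {τ : ℝ} (hτ : 0 ≤ τ) :
    ∃ C, 0 ≤ C ∧ ∀ r : ℝ, (12 + 49 * M) * |r| ≤ 1 → ∀ k : ℕ, 2 ≤ k → r ^ 2 * (k + κ) ≤ τ ^ 2 →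
      ∀ a b c : ℝ, |a| ≤ 1 → |b| ≤ 1 → |c| ≤ 1 →
        ‖expecList χ ρ k (wave κ σ r a b c) - 1‖ ≤
          C * |r| + ∑ j ∈ Finset.range k, C * (r ^ 2 / √j) := by
  have hκ0 : 0 < κ := hκ ▸ h.ratio_pos
  have hκ2 : κ ≤ 2 := hκ ▸ h.ratio_le_two
  have hM0 : 0 ≤ M := hM ▸ Finset.sum_nonneg fun i _ => abs_nonneg _
  have hS : 0 ≤ devSq κ [] := by unfold devSq; positivity
  obtain ⟨C₁, hC₁⟩ : ∃ C₁, C₁ = Real.exp (τ ^ 2 * M) *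
    (200 + 36 * M + 1728 * τ + 2401 * M ^ 2 * τ) * (2 * (devSq κ [] + 40) + 1) := ⟨_, rfl⟩
  have hC₁0 : 0 ≤ C₁ := by rw [hC₁]; positivity
  refine ⟨2 * (12 + 4 * M) + C₁, by positivity, fun r hr k hk => ?_⟩
  have hr0 := abs_nonneg r
  induction k, hk using Nat.le_induction with
  | base =>
    intro _ a b c ha hb hc
    have h1 : expecList χ ρ 2 (wave κ σ r a b c) - 1 =
        expecList χ ρ 2 (fun l => wave κ σ r a b c l - 1) := by
      rw [expecList_sub, h.expecList_const]
    rw [h1]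
    have h2 := h.norm_expecList_le 2 (g := fun _ => 2 * (12 + 4 * M) * |r|) fun l _ hl =>
      norm_wave_sub_one_le hκ0 hκ2 hM hr hl ha hb hc
    rw [h.expecList_const] at h2
    have h3 : 0 ≤ ∑ j ∈ Finset.range 2, (2 * (12 + 4 * M) + C₁) * (r ^ 2 / √j) :=
      Finset.sum_nonneg fun j _ => by positivity
    have h4 : 0 ≤ C₁ * |r| := by positivity
    linarith
  | succ k hk ih =>
    intro hrk a b c ha hb hc
    have hk' : (2 : ℝ) ≤ k := by exact_mod_cast hk
    push_cast at hrk
    have hN : 0 < (k : ℝ) + κ := by positivity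
    have h1 := h.norm_expecList_wave_succ_sub_le hκ hσ hM hτ hr (by omega : 1 ≤ k)
      (by linarith) ha hb hc
    rw [← hC₁] at h1
    have h2 := ih (by nlinarith [sq_nonneg r]) _ _ _
      (abs_add_mul_sub_div_le hκ0.le hN (by linarith) ha hb)
      (abs_add_mul_sub_div_le (by linarith : 0 ≤ 1 + κ) hN (by linarith) hb hc)
      (abs_add_mul_sub_div_le (by linarith : 0 ≤ 2 + κ) hN (by linarith) hc
        (by norm_num : |(0 : ℝ)| ≤ 1))
    rw [show (2 + κ) * (0 - c) = -((2 + κ) * c) by ring] at h2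
    rw [Finset.sum_range_succ]
    have h3 : 0 ≤ 2 * (12 + 4 * M) * (r ^ 2 / √k) := by positivity
    refine (norm_sub_le_norm_sub_add_norm_sub _ _ _).trans (add_le_add h1 h2 |>.trans ?_)
    linarith

end Recursion

section Convergence

open MeasureTheory Filter Topology Complex

variable {χ ρ κ : ℝ}

lemma tendsto_natCast_add_div (κ : ℝ) :
    Tendsto (fun n : ℕ => ((n : ℝ) + κ) / (n + 1)) atTop (𝓝 1) := by
  have h := (tendsto_one_div_add_atTop_nhds_zero_nat (𝕜 := ℝ)).const_mul (κ - 1) |>.const_add 1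
  rw [mul_zero, add_zero] at h
  refine h.congr fun n => ?_
  have : (n : ℝ) + 1 ≠ 0 := by positivity
  field_simp
  ring

lemma tendsto_inv_sqrt_natCast_add_one :
    Tendsto (fun n : ℕ => 1 / √((n : ℝ) + 1)) atTop (𝓝 0) := by
  have h := (tendsto_one_div_add_atTop_nhds_zero_nat (𝕜 := ℝ)).sqrt
  rw [Real.sqrt_zero] at h
  refine h.congr fun n => ?_
  rw [Real.sqrt_div zero_le_one, Real.sqrt_one]

lemma tendsto_cesaro_inv_sqrt :
    Tendsto (fun n : ℕ => (n : ℝ)⁻¹ * ∑ j ∈ Finset.range n, 1 / √(j : ℝ)) atTop (𝓝 0) := by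
  refine Tendsto.cesaro ?_
  rw [← tendsto_add_atTop_iff_nat 1]
  simpa using tendsto_inv_sqrt_natCast_add_one

lemma Admissible.tendsto_expecList_wave (h : Admissible χ ρ) (hκ : ρ / (χ + ρ) = κ)
    {σ : Fin 6 → ℝ} (hσ : ∀ a b c : ℝ, bilin3 σ a b c a b c -
      2 * bilin3 σ a b c (κ * (b - a)) ((1 + κ) * (c - b)) (-((2 + κ) * c)) = stepVar κ a b c)
    (t : ℝ) {a b c : ℝ} (ha : |a| ≤ 1) (hb : |b| ≤ 1) (hc : |c| ≤ 1) :
    Tendsto (fun n : ℕ => expecList χ ρ n (wave κ σ (t * (1 / √((n : ℝ) + 1))) a b c)) atTop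
      (𝓝 1) := by
  have hκ0 : 0 < κ := hκ ▸ h.ratio_pos
  have hκ2 : κ ≤ 2 := hκ ▸ h.ratio_le_two
  obtain ⟨C, hC0, hC⟩ := h.norm_expecList_wave_sub_one_le hκ hσ rfl (τ := 2 * |t|) (by positivity)
  rw [tendsto_iff_norm_sub_tendsto_zero]
  have hr : Tendsto (fun n : ℕ => |t * (1 / √((n : ℝ) + 1))|) atTop (𝓝 0) := by
    simpa using (tendsto_inv_sqrt_natCast_add_one.const_mul t).abs
  have hbound : Tendsto (fun n : ℕ => C * |t * (1 / √((n : ℝ) + 1))| +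
      C * t ^ 2 * ((n : ℝ)⁻¹ * ∑ j ∈ Finset.range n, 1 / √(j : ℝ))) atTop (𝓝 0) := by
    simpa using (hr.const_mul C).add (tendsto_cesaro_inv_sqrt.const_mul (C * t ^ 2))
  have hsmall : ∀ᶠ n : ℕ in atTop,
      (12 + 49 * ∑ i, |σ i|) * |t * (1 / √((n : ℝ) + 1))| ≤ 1 := by
    have := hr.const_mul (12 + 49 * ∑ i, |σ i|)
    rw [mul_zero] at this
    exact this.eventually_le_const one_pos
  refine squeeze_zero' (Eventually.of_forall fun _ => norm_nonneg _) ?_ hbound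
  filter_upwards [hsmall, eventually_ge_atTop 2] with n hn hn2
  have hn0 : 0 < (n : ℝ) := by exact_mod_cast (by omega : 0 < n)
  have hsq : (t * (1 / √((n : ℝ) + 1))) ^ 2 = t ^ 2 / (n + 1) := by
    rw [mul_pow, div_pow, Real.sq_sqrt (by positivity), one_pow, mul_one_div]
  refine (hC _ hn n hn2 ?_ a b c ha hb hc).trans (add_le_add le_rfl ?_)
  · rw [hsq, mul_pow, sq_abs, div_mul_eq_mul_div, div_le_iff₀ (by positivity)]
    nlinarith [sq_nonneg t, mul_nonneg (sq_nonneg t) hn0.le]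
  · rw [Finset.mul_sum, Finset.mul_sum]
    refine Finset.sum_le_sum fun j _ => ?_
    rw [hsq]
    calc C * (t ^ 2 / (n + 1) / √(j : ℝ)) ≤ C * (t ^ 2 / n / √(j : ℝ)) := by
          gcongr
          linarith
      _ = _ := by
          rw [div_eq_mul_inv _ (√(j : ℝ)), one_div, div_eq_mul_inv]
          ring

lemma Admissible.tendsto_expecList_cexp_dev3 (h : Admissible χ ρ) (hκ : ρ / (χ + ρ) = κ) (t : ℝ) :
    Tendsto (fun n : ℕ => expecList χ ρ n
      (fun l => cexp ((t * (1 / √((n : ℝ) + 1)) * dev3 κ l : ℝ) * I))) atTop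
      (𝓝 (cexp ((-(sigma3sq κ * t ^ 2 / 2) : ℝ)))) := by
  obtain ⟨σ, hσ3, hσ⟩ := exists_covariance (hκ ▸ h.ratio_pos : 0 < κ)
  have hwave := h.tendsto_expecList_wave hκ hσ t (a := 0) (b := 0) (c := 1) (by norm_num)
    (by norm_num) (by norm_num)
  have hG : Tendsto (fun n : ℕ => cexp ((-(sigma3sq κ * t ^ 2 / 2 * ((n + κ) / (n + 1))) : ℝ)))
      atTop (𝓝 (cexp ((-(sigma3sq κ * t ^ 2 / 2) : ℝ)))) := by
    have := (((tendsto_natCast_add_div κ).const_mul (sigma3sq κ * t ^ 2 / 2)).neg).ofReal.cexp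
    rwa [mul_one] at this
  have hmul := hG.mul hwave
  rw [mul_one] at hmul
  refine hmul.congr fun n => ?_
  simp only [expecList, Finset.mul_sum]
  refine Finset.sum_congr rfl fun p _ => ?_
  rw [mul_smul_comm, wave, ← Complex.exp_add, ← add_assoc, ← Complex.ofReal_add, length_toList,
    Nat.add_sub_cancel]
  have e : -(sigma3sq κ * t ^ 2 / 2 * (((n : ℝ) + κ) / (n + 1))) +
      (t * (1 / √((n : ℝ) + 1))) ^ 2 / 2 * ((n + κ) * bilin3 σ 0 0 1 0 0 1) = 0 := by
    rw [mul_pow, div_pow, Real.sq_sqrt (by positivity), one_pow, ← hσ3, bilin3]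
    ring
  rw [e, Complex.ofReal_zero, zero_add, zero_mul, zero_mul, zero_add, zero_add, one_mul]

/-- Convergence of characteristic functions implies convergence in distribution. -/
lemma Admissible.tendstoGaussP (h : Admissible χ ρ) {W : (n : ℕ) → Omega n → ℝ} {v : NNReal}
    (hW : ∀ t : ℝ, Tendsto (fun n : ℕ => ∑ p : Omega (n + 1),
      prob χ ρ (toList p) • cexp ((t * W (n + 1) p : ℝ) * I)) atTop
      (𝓝 (cexp ((-(v * t ^ 2 / 2) : ℝ))))) :
    TendstoGaussP χ ρ W v := by
  have hsum : ∀ n, ∑ p : Omega (n + 1), ENNReal.ofReal (prob χ ρ (toList p)) = 1 := fun n => by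
    rw [← ENNReal.ofReal_sum_of_nonneg fun p _ => h.prob_nonneg n p, h.sum_prob,
      ENNReal.ofReal_one]
  have hprob : ∀ n, IsProbabilityMeasure (∑ p : Omega (n + 1),
      ENNReal.ofReal (prob χ ρ (toList p)) • Measure.dirac (W (n + 1) p)) := fun n =>
    ⟨by simp [Measure.finsetSum_apply, hsum]⟩
  obtain ⟨μ, hμ⟩ : ∃ μ : ℕ → ProbabilityMeasure ℝ, ∀ n, (μ n : Measure ℝ) =
      ∑ p : Omega (n + 1), ENNReal.ofReal (prob χ ρ (toList p)) • Measure.dirac (W (n + 1) p) :=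
    ⟨fun n => ⟨_, hprob n⟩, fun n => rfl⟩
  obtain ⟨ν, hν⟩ : ∃ ν : ProbabilityMeasure ℝ,
      (ν : Measure ℝ) = ProbabilityTheory.gaussianReal 0 v :=
    ⟨⟨ProbabilityTheory.gaussianReal 0 v, inferInstance⟩, rfl⟩
  have hint : ∀ {F : Type} [NormedAddCommGroup F] [NormedSpace ℝ F] [CompleteSpace F] (n : ℕ)
      (f : ℝ → F), ∫ x, f x ∂(μ n : Measure ℝ) =
        ∑ p : Omega (n + 1), prob χ ρ (toList p) • f (W (n + 1) p) := by
    intro F _ _ _ n f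
    rw [hμ, integral_finsetSum_measure fun p _ =>
      (integrable_dirac (by simp [enorm_lt_top])).smul_measure ENNReal.ofReal_ne_top]
    refine Finset.sum_congr rfl fun p _ => ?_
    rw [integral_smul_measure, integral_dirac, ENNReal.toReal_ofReal (h.prob_nonneg n p)]
  have hlim : Tendsto μ atTop (𝓝 ν) := by
    refine ProbabilityMeasure.tendsto_iff_tendsto_charFun.2 fun t => ?_
    have ht : charFun (ν : Measure ℝ) t = cexp ((-(v * t ^ 2 / 2) : ℝ)) := by
      rw [hν, ProbabilityTheory.charFun_gaussianReal]
      congr 1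
      push_cast
      ring
    rw [ht]
    refine (hW t).congr fun n => ?_
    rw [charFun_apply_real, hint]
    push_cast
    rfl
  intro f
  rw [← tendsto_add_atTop_iff_nat 1, ← hν]
  refine (ProbabilityMeasure.tendsto_iff_forall_integral_tendsto.1 hlim f).congr fun n => ?_
  rw [hint]
  rfl

lemma sigma3sq_pos (hκ : 0 < κ) : 0 < sigma3sq κ := by
  unfold sigma3sq
  positivity

lemma Admissible.tendstoGaussP_countSize_three (h : Admissible χ ρ) (hκ : ρ / (χ + ρ) = κ) :
    TendstoGaussP χ ρ (fun n p => ((countSize (toList p) n 3 : ℝ) -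
      κ * (n : ℝ) / ((κ + 2) * (κ + 3))) / √n) (sigma3sq κ).toNNReal := by
  have hκ0 : 0 < κ := hκ ▸ h.ratio_pos
  refine h.tendstoGaussP fun t => ?_
  rw [Real.coe_toNNReal _ (sigma3sq_pos hκ0).le]
  have hshift : Tendsto (fun n : ℕ =>
      cexp ((t * (1 / √((n : ℝ) + 1)) * (mean3 κ * (κ - 1)) : ℝ) * I)) atTop (𝓝 1) := by
    have := ((((tendsto_inv_sqrt_natCast_add_one.const_mul t).mul_const
      (mean3 κ * (κ - 1))).ofReal).mul_const I).cexp
    simpa using this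
  have hmul := (h.tendsto_expecList_cexp_dev3 hκ t).mul hshift
  rw [mul_one] at hmul
  refine hmul.congr fun n => ?_
  rw [expecList, Finset.sum_mul]
  refine Finset.sum_congr rfl fun p _ => ?_
  have hlen : (toList p).length = n := length_toList p
  have hcount := countSize_eq_fringeCount (toList p) 3
  rw [hlen] at hcount
  rw [smul_mul_assoc, ← Complex.exp_add, ← add_mul, ← Complex.ofReal_add, hcount, dev3, mean3, hlen]
  congr 4
  push_cast
  ring

end Convergence

/-- **Theorem (fringe subtrees with 3 nodes in linear preferential attachment
trees).** With `κ := ρ/(χ+ρ)`, the number `Y_{n,3}` of fringe subtrees with exactly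
3 nodes in `Λ_n` satisfies `n^{-1/2}(Y_{n,3} − κn/((κ+2)(κ+3))) → N(0, σ₃²)` with
`σ₃² = 3κ(11κ³+52κ²+77κ+30)/(2(κ+2)(κ+3)²(2κ+1)(2κ+3)(2κ+5))`; in particular
`σ₃² = 17/336` for `κ = 1` (random recursive tree), `σ₃² = 8/175` for `κ = 2`
(binary search tree) and `σ₃² = 663/15680` for `κ = 1/2` (plane oriented recursive
tree). -/
theorem pat_fringe_three_clt (χ ρ : ℝ)
    (hχ : χ = -1 ∨ χ = 0 ∨ χ = 1) (hρ : 0 < ρ)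
    (hint : χ = -1 → ∃ m : ℕ, 2 ≤ m ∧ ρ = m) :
    TendstoGaussP χ ρ (fun n p =>
        ((countSize (toList p) n 3 : ℝ)
            - (ρ / (χ + ρ)) * (n : ℝ)
                / ((ρ / (χ + ρ) + 2) * (ρ / (χ + ρ) + 3))) / Real.sqrt n)
      (sigma3sq (ρ / (χ + ρ))).toNNReal ∧
    0 < sigma3sq (ρ / (χ + ρ)) ∧
    sigma3sq 1 = 17 / 336 ∧ sigma3sq 2 = 8 / 175 ∧ sigma3sq (1 / 2) = 663 / 15680 := by
  have h : Admissible χ ρ := ⟨hχ, hρ, hint⟩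
  refine ⟨h.tendstoGaussP_countSize_three rfl, sigma3sq_pos h.ratio_pos, ?_, ?_, ?_⟩ <;>
    norm_num [sigma3sq]

end PATpaper
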